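/- Let P be a lattice polytope of degree d such that the leading coefficient of its h*-polynomial is h*_d = k. Then the normalized volume Vol(P) is bounded above by a number that depends only on d and k; that is, there is a function B : ℕ × ℕ → ℝ such that for every n and every n-dimensional lattice polytope P of degree d with h*_d = k, one has Vol(P) ≤ B(d, k), independently of the dimension n. -/

import Mathlib

open scoped BigOperators Pointwise

noncomputable section

/-- A point of `ℝ^m` with integer coordinates (a lattice point). -/
def IsLatticePoint {m : ℕ} (v : Fin m → ℝ) : Prop := ∀ i, ∃ z : ℤ, v i = (z : ℝ)

/-- `P` is a lattice polytope in `ℝ^m`: the convex hull of a nonempty finite set of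
lattice points. -/
def IsLatticePolytope {m : ℕ} (P : Set (Fin m → ℝ)) : Prop :=
  ∃ V : Finset (Fin m → ℝ), V.Nonempty ∧ (∀ v ∈ V, IsLatticePoint v) ∧
    P = convexHull ℝ (V : Set (Fin m → ℝ))

/-- The number of lattice points contained in a subset of `ℝ^m`. -/
def latticePointCount {m : ℕ} (A : Set (Fin m → ℝ)) : ℕ :=
  Set.ncard {z : Fin m → ℤ | (fun i => (z i : ℝ)) ∈ A}

/-- `h` is the `h^*`-polynomial of the full-dimensional lattice polytope `P ⊆ ℝ^n`:
its coefficients are nonnegative, it has degree at most `n`, and the Ehrhart counting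
function of `P` is given by `|mP ∩ ℤ^n| = ∑_i h_i * C(n + m - i, n)`, which is
equivalent to `∑_m |mP ∩ ℤ^n| t^m = h(t)/(1-t)^{n+1}`. -/
def IsHStarPoly {n : ℕ} (P : Set (Fin n → ℝ)) (h : Polynomial ℤ) : Prop :=
  h.natDegree ≤ n ∧ (∀ i, 0 ≤ h.coeff i) ∧
    ∀ m : ℕ, (latticePointCount ((m : ℝ) • P) : ℤ) =
      ∑ i ∈ Finset.range (n + 1), h.coeff i * ((n + m - i).choose n : ℤ)

/-- The normalized volume of a (full-dimensional) polytope in `ℝ^m`: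
`m!` times its Euclidean volume. -/
def normVol {m : ℕ} (P : Set (Fin m → ℝ)) : ℝ :=
  (Nat.factorial m : ℝ) * (MeasureTheory.volume P).toReal

/-- The point of `ℝ^s` over which the `j`-th summand of a Cayley sum sits:
`0` for `j = 0`, and the standard basis vector `e_j` for `j = 1, …, s`. -/
def cayleyVertex (s : ℕ) (j : Fin (s + 1)) : Fin s → ℝ :=
  fun i => if (i : ℕ) + 1 = (j : ℕ) then 1 else 0

/-- The Cayley sum `P_0 * ⋯ * P_s ⊆ ℝ^q × ℝ^s` of polytopes `P_0, …, P_s ⊆ ℝ^q`: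
the convex hull of `(P_0 × {0}) ∪ (P_1 × {e_1}) ∪ ⋯ ∪ (P_s × {e_s})`. -/
def CayleySum {q s : ℕ} (Ps : Fin (s + 1) → Set (Fin q → ℝ)) :
    Set ((Fin q → ℝ) × (Fin s → ℝ)) :=
  convexHull ℝ (⋃ j : Fin (s + 1), (fun p => (p, cayleyVertex s j)) '' Ps j)

/-- A lattice point of `ℝ^q × ℝ^s`. -/
def IsLatticePointPair {q s : ℕ} (v : (Fin q → ℝ) × (Fin s → ℝ)) : Prop :=
  IsLatticePoint v.1 ∧ IsLatticePoint v.2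

/-- An affine isomorphism `ℝ^n ≅ ℝ^q × ℝ^s` is a `ℤ`-affine linear change of coordinates
if it identifies the lattice `ℤ^n` with the lattice `ℤ^q × ℤ^s`. -/
def IsLatticeEquiv {n q s : ℕ} (T : (Fin n → ℝ) ≃ᵃ[ℝ] (Fin q → ℝ) × (Fin s → ℝ)) : Prop :=
  ∀ v : Fin n → ℝ, IsLatticePoint v ↔ IsLatticePointPair (T v)

namespace LatticeCone

set_option linter.unusedSectionVars false

variable {ι W : Type*} [Fintype ι] [DecidableEq ι] [AddCommGroup W] [Module ℝ W]

/-- `y` lies in the cone generated by the family `a`. -/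
def InCone (a : ι → W) (y : W) : Prop := ∃ c : ι → ℝ, (∀ i, 0 ≤ c i) ∧ ∑ i, c i • a i = y

/-- `y` is a strictly positive combination of the family `a`; when `a` spans, this is
membership in the interior of the cone generated by `a`. -/
def InInt (a : ι → W) (y : W) : Prop := ∃ c : ι → ℝ, (∀ i, 0 < c i) ∧ ∑ i, c i • a i = y

/-- `f` computes the coordinates of vectors with respect to the subfamily of `a` indexed by `B`. -/
structure IsCoord (a : ι → W) (B : Finset ι) (f : W →ₗ[ℝ] ι → ℝ) : Prop where
  sum_apply : ∀ y, ∑ i, f y i • a i = y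
  apply_of_notMem : ∀ y, ∀ i ∉ B, f y i = 0
  apply_sum : ∀ c : ι → ℝ, (∀ i ∉ B, c i = 0) → f (∑ i, c i • a i) = c

/-- The subfamily of `a` indexed by `B` is a basis. -/
def IsBase (a : ι → W) (B : Finset ι) : Prop := ∃ f, IsCoord a B f

open Classical in
/-- The coordinates with respect to the subfamily of `a` indexed by `B`
(junk value `0` if it is not a basis). -/
def coord (a : ι → W) (B : Finset ι) : W →ₗ[ℝ] ι → ℝ :=
  if h : IsBase a B then h.choose else 0

variable {a : ι → W} {B : Finset ι}

lemma IsBase.isCoord (h : IsBase a B) : IsCoord a B (coord a B) := by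
  rw [coord, dif_pos h]; exact h.choose_spec

lemma IsCoord.isBase {f : W →ₗ[ℝ] ι → ℝ} (h : IsCoord a B f) : IsBase a B := ⟨f, h⟩

lemma IsCoord.eq_coord {f : W →ₗ[ℝ] ι → ℝ} (h : IsCoord a B f) : coord a B = f := by
  have h' := h.isBase.isCoord
  ext1 y
  conv_lhs => rw [← h.sum_apply y]
  exact h'.apply_sum _ (h.apply_of_notMem y)

lemma IsCoord.apply_self {f : W →ₗ[ℝ] ι → ℝ} (h : IsCoord a B f) {j : ι} (hj : j ∈ B) :
    f (a j) = Pi.single j 1 := by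
  have := h.apply_sum (Pi.single j 1) (fun i hi => by
    rw [Pi.single_eq_of_ne]; rintro rfl; exact hi hj)
  simpa [Pi.single_apply, ite_smul] using this

lemma IsBase.coord_self (h : IsBase a B) {j : ι} (hj : j ∈ B) :
    coord a B (a j) = Pi.single j 1 := h.isCoord.apply_self hj

lemma IsBase.sum_coord_mem (h : IsBase a B) (y : W) : ∑ i ∈ B, coord a B y i • a i = y := by
  conv_rhs => rw [← h.isCoord.sum_apply y]
  exact Finset.sum_subset (Finset.subset_univ _) fun i _ hi => by
    rw [h.isCoord.apply_of_notMem y i hi, zero_smul]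

lemma coord_sum (c : ι → ℝ) (B : Finset ι) (j : ι) :
    coord a B (∑ i, c i • a i) j = ∑ i, c i * coord a B (a i) j := by
  simp [map_sum]

/-- A basis of `W` consisting of members of the family `a` gives a base. -/
lemma isBase_of_basis {κ : Type*} [Fintype κ] (bs : Module.Basis κ ℝ W) (b : κ → ι)
    (hb : ∀ l, bs l = a (b l)) :
    IsBase a (Finset.univ.image b) ∧
      ∀ y l, coord a (Finset.univ.image b) y (b l) = bs.repr y l := by
  have hinj : Function.Injective b := fun l l' h => bs.injective (by rw [hb, hb, h])
  let f : W →ₗ[ℝ] ι → ℝ := ∑ l, (LinearMap.single ℝ (fun _ : ι => ℝ) (b l)) ∘ₗ (bs.coord l)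
  have hf : ∀ y i, f y i = ∑ l, if i = b l then bs.repr y l else 0 := by
    intro y i
    simp [f, LinearMap.sum_apply, Finset.sum_apply, Pi.single_apply]
  have hfb : ∀ y l, f y (b l) = bs.repr y l := by
    intro y l
    rw [hf, Finset.sum_eq_single l]
    · rw [if_pos rfl]
    · intro l' _ hl
      exact if_neg fun h => hl (hinj h).symm
    · simp
  have hsum : ∀ c : ι → ℝ, (∀ i ∉ Finset.univ.image b, c i = 0) →
      ∑ i, c i • a i = ∑ l, c (b l) • bs l := by
    intro c hc
    rw [← Finset.sum_subset (Finset.subset_univ (Finset.univ.image b))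
      (fun i _ hi => by rw [hc i hi, zero_smul]), Finset.sum_image (fun _ _ _ _ h => hinj h)]
    simp only [hb]
  have h0 : ∀ y, ∀ i ∉ Finset.univ.image b, f y i = 0 := by
    intro y i hi
    rw [hf]
    refine Finset.sum_eq_zero fun l _ => if_neg ?_
    rintro rfl
    exact hi (Finset.mem_image_of_mem _ (Finset.mem_univ _))
  have hc : IsCoord a (Finset.univ.image b) f := by
    refine ⟨fun y => ?_, h0, fun c hc => ?_⟩
    · rw [hsum _ (h0 y)]
      simp only [hfb]
      exact bs.sum_repr y
    · ext i
      by_cases hi : i ∈ Finset.univ.image b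
      · obtain ⟨l, -, rfl⟩ := Finset.mem_image.1 hi
        rw [hfb, hsum c hc, bs.repr_sum_self]
      · rw [h0 _ i hi, hc i hi]
  refine ⟨hc.isBase, fun y l => ?_⟩
  rw [hc.eq_coord, hfb]

lemma IsBase.card_eq [FiniteDimensional ℝ W] (h : IsBase a B) : B.card = Module.finrank ℝ W := by
  have hl : LinearIndependent ℝ (fun i : B => a i) := by
    rw [Fintype.linearIndependent_iff]
    intro g hg i
    have := h.isCoord.apply_sum (fun j => if hj : j ∈ B then g ⟨j, hj⟩ else 0)
      (fun j hj => by simp [hj])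
    have h2 : ∑ j, (if hj : j ∈ B then g ⟨j, hj⟩ else 0) • a j = ∑ j : B, g j • a j := by
      rw [← Finset.sum_subset (Finset.subset_univ B) (fun j _ hj => by simp [hj]),
        ← Finset.sum_coe_sort]
      simp
    rw [h2, hg, map_zero] at this
    simpa using (congrFun this i).symm
  have hs : ⊤ ≤ Submodule.span ℝ (Set.range (fun i : B => a i)) := by
    intro y _
    rw [← h.sum_coord_mem y]
    exact Submodule.sum_mem _ fun i hi => Submodule.smul_mem _ _
      (Submodule.subset_span ⟨⟨i, hi⟩, rfl⟩)
  have := Module.finrank_eq_card_basis (Module.Basis.mk hl hs)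
  simp [this]

/-- Exchange of the basis element `j` for the vector `a i`. -/
lemma IsBase.exchange (h : IsBase a B) {i j : ι} (hi : i ∉ B) (hj : j ∈ B)
    (hγ : coord a B (a i) j ≠ 0) :
    IsBase a (insert i (B.erase j)) ∧ ∀ y, coord a (insert i (B.erase j)) y =
      coord a B y + (coord a B y j / coord a B (a i) j) • (Pi.single i 1 - coord a B (a i)) := by
  set γ := coord a B (a i) with hγdef
  have hij : i ≠ j := by rintro rfl; exact hi hj
  let f : W →ₗ[ℝ] ι → ℝ := coord a B +
    ((γ j)⁻¹ • (LinearMap.proj j ∘ₗ coord a B)).smulRight (Pi.single i 1 - γ)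
  have hf : ∀ y, f y = coord a B y + (coord a B y j / γ j) • (Pi.single i 1 - γ) := by
    intro y
    simp [f, div_eq_inv_mul]
  have hc : IsCoord a (insert i (B.erase j)) f := by
    refine ⟨fun y => ?_, fun y l hl => ?_, fun c hc => ?_⟩
    · rw [hf]
      have h1 := h.isCoord.sum_apply y
      have h2 := h.isCoord.sum_apply (a i)
      rw [← hγdef] at h2
      have h3 : ∑ l, (Pi.single i (1 : ℝ) : ι → ℝ) l • a l = a i := by
        simp [Pi.single_apply, ite_smul]
      simp only [Pi.add_apply, Pi.smul_apply, Pi.sub_apply, add_smul, Finset.sum_add_distrib, h1,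
        smul_assoc, ← Finset.smul_sum, sub_smul, Finset.sum_sub_distrib, h2, h3, sub_self,
        smul_zero, add_zero]
    · rw [hf]
      simp only [Finset.mem_insert, Finset.mem_erase, not_or, not_and_or, not_not] at hl
      obtain ⟨hli, rfl | hlB⟩ := hl
      · simp [Pi.single_eq_of_ne hli, hγ]
      · simp [Pi.single_eq_of_ne hli, hγdef, h.isCoord.apply_of_notMem _ l hlB]
    · have hcj : c j = 0 := hc j (by simp [hij.symm])
      have hsplit : ∑ l, c l • a l = ∑ l, (c - c i • (Pi.single i 1 : ι → ℝ)) l • a l + c i • a i := by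
        have h3 : ∑ l, (Pi.single i (1 : ℝ) : ι → ℝ) l • a l = a i := by
          simp [Pi.single_apply, ite_smul]
        simp only [Pi.sub_apply, Pi.smul_apply, sub_smul, Finset.sum_sub_distrib, smul_assoc,
          ← Finset.smul_sum, h3, sub_add_cancel]
      have h0 : ∀ l ∉ B, (c - c i • (Pi.single i 1 : ι → ℝ)) l = 0 := by
        intro l hl
        by_cases hli : l = i
        · subst hli; simp
        · simp [hli, hc l (by simp [hli, hl])]
      have hco : coord a B (∑ l, c l • a l) = c - c i • Pi.single i 1 + c i • γ := by
        rw [hsplit, map_add, h.isCoord.apply_sum _ h0, map_smul]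
      rw [hf, hco]
      have : (c - c i • (Pi.single i 1 : ι → ℝ) + c i • γ) j / γ j = c i := by
        simp [hcj, hij.symm, hγ]
      rw [this, smul_sub]
      abel
  exact ⟨hc.isBase, fun y => by rw [hc.eq_coord, hf]⟩

lemma InInt.inCone {y : W} (h : InInt a y) : InCone a y :=
  let ⟨c, hc, hy⟩ := h; ⟨c, fun i => (hc i).le, hy⟩

lemma InInt.add {y z : W} (h : InInt a y) (hz : InCone a z) : InInt a (y + z) := by
  obtain ⟨c, hc, rfl⟩ := h
  obtain ⟨e, he, rfl⟩ := hz
  exact ⟨c + e, fun i => add_pos_of_pos_of_nonneg (hc i) (he i), by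
    simp [add_smul, Finset.sum_add_distrib]⟩

lemma InInt.smul {y : W} (h : InInt a y) {t : ℝ} (ht : 0 < t) : InInt a (t • y) := by
  obtain ⟨c, hc, rfl⟩ := h
  exact ⟨t • c, fun i => mul_pos ht (hc i), by simp [Finset.smul_sum, smul_smul]⟩

lemma InCone.add {y z : W} (h : InCone a y) (hz : InCone a z) : InCone a (y + z) := by
  obtain ⟨c, hc, rfl⟩ := h
  obtain ⟨e, he, rfl⟩ := hz
  exact ⟨c + e, fun i => add_nonneg (hc i) (he i), by
    simp [add_smul, Finset.sum_add_distrib]⟩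

/-- A finite family of reals can be perturbed slightly in any direction while the positive
entries stay positive. -/
lemma exists_small {κ : Type*} (s : Finset κ) (c e : κ → ℝ) (hc : ∀ i ∈ s, 0 < c i) :
    ∃ δ : ℝ, 0 < δ ∧ ∀ i ∈ s, 0 < c i - δ * e i := by
  classical
  induction s using Finset.induction_on with
  | empty => exact ⟨1, one_pos, by simp⟩
  | insert j s hj ih =>
    obtain ⟨δ, hδ, h⟩ := ih fun i hi => hc i (Finset.mem_insert_of_mem hi)
    have hcj := hc j (Finset.mem_insert_self _ _)
    refine ⟨min δ (c j / (|e j| + 1)), lt_min hδ (by positivity), ?_⟩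
    set δ' := min δ (c j / (|e j| + 1))
    have hδ'0 : 0 < δ' := lt_min hδ (by positivity)
    intro i hi
    rcases Finset.mem_insert.1 hi with rfl | hi
    · have h1 : δ' * (|e i| + 1) ≤ c i := (le_div_iff₀ (by positivity)).1 (min_le_right _ _)
      nlinarith [le_abs_self (e i)]
    · have h1 := h i hi
      have h2 : 0 < c i := hc i (Finset.mem_insert_of_mem hi)
      have h3 : δ' ≤ δ := min_le_left _ _
      rcases le_or_gt (e i) 0 with h4 | h4
      · nlinarith
      · nlinarith

/-- If an interior point is supported on `S`, then every combination with positive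
coefficients on `S` is interior. -/
lemma InInt.of_support {y : W} (hy : InInt a y) {e c : ι → ℝ} (hye : ∑ i, e i • a i = y)
    (hc0 : ∀ i, 0 ≤ c i) (hec : ∀ i, e i ≠ 0 → 0 < c i) : InInt a (∑ i, c i • a i) := by
  classical
  obtain ⟨δ, hδ, h⟩ := exists_small (Finset.univ.filter fun i => e i ≠ 0) c e
    (fun i hi => hec i (by simpa using hi))
  have : ∑ i, c i • a i = δ • y + ∑ i, (c i - δ * e i) • a i := by
    rw [← hye]
    simp [sub_smul, Finset.sum_sub_distrib, Finset.smul_sum, smul_smul]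
  rw [this]
  refine (hy.smul hδ).add ⟨_, fun i => ?_, rfl⟩
  by_cases hi : e i = 0
  · simpa [hi] using hc0 i
  · exact (h i (by simpa using hi)).le

lemma InInt.of_coord_pos (h : IsBase a B) {z : W} (hz : ∀ i ∈ B, 0 < coord a B z i) :
    InInt a z := by
  obtain ⟨δ, hδ, h'⟩ := exists_small B (coord a B z) (coord a B (∑ i, a i)) hz
  have hy : InInt a (∑ i, a i) := ⟨1, fun i => by simp, by simp⟩
  have : z = δ • ∑ i, a i + (z - δ • ∑ i, a i) := by abel
  rw [this]
  refine (hy.smul hδ).add ⟨coord a B (z - δ • ∑ i, a i), fun i => ?_, h.isCoord.sum_apply _⟩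
  by_cases hi : i ∈ B
  · simpa using (h' i hi).le
  · rw [h.isCoord.apply_of_notMem _ i hi]

/-- The standing hypotheses: the vectors `a i` are lattice points of height one spanning `W`. -/
structure Config (a : ι → W) (M : AddSubgroup W) (ht : W →ₗ[ℝ] ℝ) : Prop where
  mem : ∀ i, a i ∈ M
  ht_eq : ∀ i, ht (a i) = 1
  ht_int : ∀ z ∈ M, ∃ t : ℤ, ht z = t
  span : Submodule.span ℝ (Set.range a) = ⊤

variable {M : AddSubgroup W} {ht : W →ₗ[ℝ] ℝ}

lemma Config.ht_sum (C : Config a M ht) (c : ι → ℝ) : ht (∑ i, c i • a i) = ∑ i, c i := by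
  simp [C.ht_eq]

lemma Config.sum_coord (C : Config a M ht) (h : IsBase a B) (y : W) :
    ∑ i ∈ B, coord a B y i = ht y := by
  conv_rhs => rw [← h.sum_coord_mem y]
  simp [C.ht_eq]

lemma Config.exists_isBase (C : Config a M ht) : ∃ B, IsBase a B := by
  obtain ⟨κ, b, hb, hs, hl⟩ := exists_linearIndependent' ℝ a
  have : Finite κ := Finite.of_injective b hb
  have := Fintype.ofFinite κ
  rw [C.span] at hs
  exact ⟨_, (isBase_of_basis (Module.Basis.mk hl hs.ge) b (fun l => by simp)).1⟩

/-- Ratio test: which basis element leaves when `a i` enters. -/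
lemma Config.ratio_test (C : Config a M ht) (h : IsBase a B) (i : ι) {c : ι → ℝ}
    (hc : ∀ l, 0 ≤ c l) :
    ∃ j ∈ B, 0 < coord a B (a i) j ∧
      ∀ l, 0 ≤ c l - c j / coord a B (a i) j * coord a B (a i) l := by
  set γ := coord a B (a i) with hγ
  have hne : (B.filter fun l => 0 < γ l).Nonempty := by
    have h1 := C.sum_coord h (a i)
    rw [C.ht_eq] at h1
    obtain ⟨l, hl, hl'⟩ := Finset.exists_lt_of_sum_lt (s := B) (f := fun _ => (0 : ℝ)) (g := γ)
      (by simp [hγ, h1])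
    exact ⟨l, by simp [hl, hl']⟩
  obtain ⟨j, hj, hmin⟩ := Finset.exists_min_image _ (fun l => c l / γ l) hne
  rw [Finset.mem_filter] at hj
  refine ⟨j, hj.1, hj.2, fun l => ?_⟩
  have hq : 0 ≤ c j / γ j := div_nonneg (hc j) hj.2.le
  rcases le_or_gt (γ l) 0 with hl | hl
  · nlinarith [hc l]
  · have hlB : l ∈ B := by
      by_contra hlB
      rw [hγ, h.isCoord.apply_of_notMem _ l hlB] at hl
      exact lt_irrefl _ hl
    have := hmin l (by simp [hlB, hl])
    rw [le_div_iff₀ hl] at this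
    linarith

lemma Config.exists_base_add (C : Config a M ht) (h : IsBase a B) (i : ι) {y : W}
    (hy : ∀ l, 0 ≤ coord a B y l) {δ : ℝ} (hδ : 0 ≤ δ) :
    ∃ B', IsBase a B' ∧ (∀ l, 0 ≤ coord a B' (y + δ • a i) l) ∧
      δ ≤ coord a B' (y + δ • a i) i := by
  by_cases hi : i ∈ B
  · refine ⟨B, h, fun l => ?_, ?_⟩
    · have : 0 ≤ (Pi.single i (1 : ℝ) : ι → ℝ) l := by
        rw [Pi.single_apply]; split_ifs <;> simp
      simp only [map_add, map_smul, h.coord_self hi, Pi.add_apply, Pi.smul_apply, smul_eq_mul]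
      exact add_nonneg (hy l) (mul_nonneg hδ this)
    · simpa [h.coord_self hi] using hy i
  · obtain ⟨j, hj, hγ, hr⟩ := C.ratio_test h i hy
    obtain ⟨h', hco⟩ := h.exchange hi hj hγ.ne'
    have hi0 : ∀ z, coord a B z i = 0 := fun z => h.isCoord.apply_of_notMem z i hi
    have key : coord a (insert i (B.erase j)) (y + δ • a i) = coord a B y
        - (coord a B y j / coord a B (a i) j) • coord a B (a i)
        + (δ + coord a B y j / coord a B (a i) j) • Pi.single i 1 := by
      rw [hco]
      ext l
      simp only [map_add, map_smul, Pi.add_apply, Pi.smul_apply, smul_eq_mul, Pi.sub_apply]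
      field_simp
      ring
    have hq : 0 ≤ coord a B y j / coord a B (a i) j := div_nonneg (hy j) hγ.le
    refine ⟨_, h', fun l => ?_, ?_⟩
    · rw [key]
      have : 0 ≤ (Pi.single i (1 : ℝ) : ι → ℝ) l := by
        rw [Pi.single_apply]; split_ifs <;> simp
      have h1 := hr l
      simp only [Pi.add_apply, Pi.sub_apply, Pi.smul_apply, smul_eq_mul]
      positivity
    · rw [key]
      simp [hi0, hq]

/-- Carathéodory's theorem for cones. -/
lemma Config.exists_base_of_inCone (C : Config a M ht) {y : W} (hy : InCone a y) :
    ∃ B, IsBase a B ∧ ∀ l, 0 ≤ coord a B y l := by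
  obtain ⟨c, hc, rfl⟩ := hy
  induction (Finset.univ : Finset ι) using Finset.induction_on with
  | empty =>
    obtain ⟨B, hB⟩ := C.exists_isBase
    exact ⟨B, hB, by simp⟩
  | insert i s hi ih =>
    obtain ⟨B, hB, h⟩ := ih
    obtain ⟨B', hB', h', -⟩ := C.exists_base_add hB i h (hc i)
    exact ⟨B', hB', by rwa [Finset.sum_insert hi, add_comm]⟩

lemma Config.exists_base_of_inInt (C : Config a M ht) {y : W} (hy : InInt a y) (i : ι) :
    ∃ B, IsBase a B ∧ (∀ l, 0 ≤ coord a B y l) ∧ 0 < coord a B y i := by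
  obtain ⟨c, hc, rfl⟩ := hy
  obtain ⟨B, hB, h⟩ := C.exists_base_of_inCone (a := a)
    (y := ∑ l, (c - (Pi.single i (c i) : ι → ℝ)) l • a l) ⟨_, fun l => by
      by_cases hl : l = i
      · subst hl; simp
      · simp [hl, (hc l).le], rfl⟩
  obtain ⟨B', hB', h', h''⟩ := C.exists_base_add hB i h (hc i).le
  have : ∑ l, (c - (Pi.single i (c i) : ι → ℝ)) l • a l + c i • a i = ∑ l, c l • a l := by
    simp [sub_smul, Pi.single_apply, ite_smul]
  rw [this] at h' h''
  exact ⟨B', hB', h', (hc i).trans_le h''⟩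

end LatticeCone

namespace LatticeCone

/-- Dirichlet's theorem on simultaneous approximation. -/
lemma exists_simultaneous_approx {κ : Type*} (J : Finset κ) (β : κ → ℝ) {Q : ℕ} (hQ : 0 < Q) :
    ∃ m : ℕ, 0 < m ∧ m ≤ Q ^ J.card ∧ ∀ j ∈ J, ∃ b : ℤ, |m * β j - b| < 1 / Q := by
  classical
  have hQ' : (0 : ℝ) < Q := by exact_mod_cast hQ
  have hlt : ∀ x : ℝ, ⌊Q * Int.fract x⌋₊ < Q := fun x => by
    rw [Nat.floor_lt (by positivity)]
    nlinarith [Int.fract_lt_one x]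
  let f : ℕ → J → Fin Q := fun n j => ⟨⌊Q * Int.fract (n * β j)⌋₊, hlt _⟩
  obtain ⟨x, hx, y, hy, hxy, hf⟩ := Finset.exists_ne_map_eq_of_card_lt_of_maps_to
    (s := Finset.range (Q ^ J.card + 1)) (t := Finset.univ) (f := f) (by simp) (fun _ _ => by simp)
  wlog hlt' : x < y generalizing x y
  · exact this y hy x hx hxy.symm hf.symm (by omega)
  simp only [Finset.mem_range] at hx hy
  refine ⟨y - x, by omega, by omega, fun j hj => ⟨⌊y * β j⌋ - ⌊x * β j⌋, ?_⟩⟩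
  have h1 : ⌊Q * Int.fract (x * β j)⌋₊ = ⌊Q * Int.fract (y * β j)⌋₊ := by
    simpa [f] using congrFun hf ⟨j, hj⟩
  have h2 : |Q * Int.fract (x * β j) - Q * Int.fract (y * β j)| < 1 := by
    have e1 := Nat.floor_le (a := Q * Int.fract (x * β j)) (by positivity)
    have e2 := Nat.lt_floor_add_one (Q * Int.fract (x * β j))
    have e3 := Nat.floor_le (a := Q * Int.fract (y * β j)) (by positivity)
    have e4 := Nat.lt_floor_add_one (Q * Int.fract (y * β j))
    rw [h1] at e1 e2
    rw [abs_lt]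
    constructor <;> linarith
  rw [← mul_sub, abs_mul, abs_of_pos hQ'] at h2
  rw [lt_div_iff₀ hQ', mul_comm, abs_sub_comm]
  have h3 : ((⌊y * β j⌋ - ⌊x * β j⌋ : ℤ) : ℝ) - ((y - x : ℕ) : ℝ) * β j =
      Int.fract (x * β j) - Int.fract (y * β j) := by
    rw [← Int.self_sub_floor, ← Int.self_sub_floor]
    push_cast [Nat.cast_sub hlt'.le]
    ring
  rwa [h3]

/-- A diophantine dichotomy: if one of at most `D` reals in `(0, 1)` is very small, there are
simultaneous approximations, by `0` at the small one, with errors that are small relative to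
the reals themselves. -/
lemma exists_gap_approx (D K : ℕ) :
    ∃ ε : ℝ, 0 < ε ∧ ∀ {κ : Type} (J : Finset κ) (β : κ → ℝ), J.card ≤ D →
      (∀ j ∈ J, 0 < β j) → ∀ i ∈ J, β i < ε → ∃ (m : ℕ) (b : κ → ℤ), 0 < m ∧ b i = 0 ∧
        ∀ j ∈ J, K * (b j - m * β j) < β j ∧ K * |m * β j - b j| < 1 := by
  classical
  suffices H : ∀ l : ℕ, ∃ t : ℝ, 0 < t ∧ t ≤ 1 ∧ ∀ {κ : Type} (J : Finset κ) (β : κ → ℝ),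
      J.card ≤ D → (∀ j ∈ J, 0 < β j) → ∀ i ∈ J, β i < t →
      l ≤ (J.filter fun j => t ≤ β j).card ∨ ∃ (m : ℕ) (b : κ → ℤ), 0 < m ∧ b i = 0 ∧
        ∀ j ∈ J, K * (b j - m * β j) < β j ∧ K * |m * β j - b j| < 1 by
    obtain ⟨t, ht, -, h⟩ := H D
    refine ⟨t, ht, fun J β hJ hβ i hi hit => (h J β hJ hβ i hi hit).resolve_left ?_⟩
    have : (J.filter fun j => t ≤ β j).card < J.card := Finset.card_lt_card <|
      Finset.filter_ssubset.2 ⟨i, hi, not_le.2 hit⟩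
    omega
  intro l
  induction l with
  | zero => exact ⟨1, one_pos, le_rfl, fun _ _ _ _ _ _ _ => Or.inl (Nat.zero_le _)⟩
  | succ l ih =>
    obtain ⟨t, ht, ht1, h⟩ := ih
    obtain ⟨Q, hQ⟩ := exists_nat_gt ((K + 1) / t)
    have hQ0 : (0 : ℝ) < Q := lt_of_le_of_lt (by positivity) hQ
    have hQ1 : 0 < Q := by exact_mod_cast hQ0
    rw [div_lt_iff₀ ht] at hQ
    have hpos : (0 : ℝ) < K * Q ^ D + 1 := by positivity
    refine ⟨min t (1 / (K * Q ^ D + 1)), by positivity, (min_le_left _ _).trans ht1, ?_⟩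
    intro κ J β hJ hβ i hi hit
    rcases h J β hJ hβ i hi (hit.trans_le (min_le_left _ _)) with h | h
    swap
    · exact Or.inr h
    set t' := min t (1 / (K * Q ^ D + 1)) with ht'
    by_cases hc : l + 1 ≤ (J.filter fun j => t' ≤ β j).card
    · exact Or.inl hc
    have heq : (J.filter fun j => t ≤ β j) = J.filter fun j => t' ≤ β j :=
      Finset.eq_of_subset_of_card_le
        (Finset.monotone_filter_right _ fun j _ hj => (min_le_left _ _).trans hj) (by omega)
    obtain ⟨m, hm, hmQ, hb⟩ := exists_simultaneous_approx (J.filter fun j => t ≤ β j) β hQ1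
    choose! b hb using hb
    have hmQ' : (m : ℝ) ≤ Q ^ D := by
      exact_mod_cast hmQ.trans (Nat.pow_le_pow_right hQ1 ((Finset.card_filter_le _ _).trans hJ))
    refine Or.inr ⟨m, fun j => if t ≤ β j then b j else 0, hm, ?_, fun j hj => ?_⟩
    · exact if_neg (not_le.2 (hit.trans_le (min_le_left _ _)))
    · have hβj := hβ j hj
      by_cases hjt : t ≤ β j
      · have := hb j (by simp [hj, hjt])
        rw [lt_div_iff₀ hQ0] at this
        simp only [if_pos hjt]
        have hK : (K : ℝ) < t * Q := by linarith
        have h3 : K * |m * β j - b j| ≤ |m * β j - b j| * Q * t := by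
          nlinarith [abs_nonneg (m * β j - b j)]
        have h4 : K * |m * β j - b j| < t := by nlinarith
        refine ⟨?_, by linarith⟩
        have h5 : K * (b j - m * β j) ≤ K * |m * β j - b j| := by
          rw [abs_sub_comm]
          exact mul_le_mul_of_nonneg_left (le_abs_self _) (by positivity)
        linarith
      · have hjt' : β j < t' := by
          by_contra hcon
          have : j ∈ J.filter fun j => t ≤ β j := by
            rw [heq]; simp [hj, not_lt.1 hcon]
          exact hjt (Finset.mem_filter.1 this).2
        have h2 : β j < 1 / (K * Q ^ D + 1) := hjt'.trans_le (min_le_right _ _)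
        rw [lt_div_iff₀ hpos] at h2
        simp only [if_neg hjt, Int.cast_zero, zero_sub, sub_zero]
        have hm0 : 0 ≤ K * (m * β j) := by positivity
        rw [abs_of_nonneg (by positivity)]
        refine ⟨by linarith, ?_⟩
        have : K * (m * β j) ≤ β j * (K * Q ^ D) := by
          have : (K : ℝ) * m ≤ K * Q ^ D := by gcongr
          nlinarith
        linarith

end LatticeCone

namespace LatticeCone

set_option linter.unusedSectionVars false

variable {ι W : Type*} [Fintype ι] [DecidableEq ι] [AddCommGroup W] [Module ℝ W]
  {a : ι → W} {B : Finset ι} {M : AddSubgroup W} {ht : W →ₗ[ℝ] ℝ} {N d k : ℕ}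

/-- A real number that is not an integer. -/
def NonInt (r : ℝ) : Prop := ¬ ∃ t : ℤ, r = t

/-- The dimension is `N - 1`, interior lattice points of the cone have height at least `N - d`, and
at most `k` of them have height equal to `N - d`. -/
structure BoundedConfig (a : ι → W) (M : AddSubgroup W) (ht : W →ₗ[ℝ] ℝ) (N d k : ℕ) : Prop
    extends Config a M ht where
  card_base : ∀ B, IsBase a B → B.card = N
  int_height : ∀ z ∈ M, InInt a z → (N : ℝ) ≤ ht z + d
  few : ∀ z : ℕ → W, (∀ t ≤ k, z t ∈ M ∧ InInt a (z t) ∧ ht (z t) + d = N) →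
    ¬ Set.InjOn z (Set.Iic k)

/-- An interior lattice point of minimal height `N - d`. -/
structure IsMinPoint (a : ι → W) (M : AddSubgroup W) (ht : W →ₗ[ℝ] ℝ) (N d : ℕ) (x : W) :
    Prop where
  mem : x ∈ M
  inInt : InInt a x
  height : ht x + d = N

lemma Config.sum_mem (C : Config a M ht) (e : ι → ℤ) : ∑ i, (e i : ℝ) • a i ∈ M :=
  AddSubgroup.sum_mem _ fun i _ => by
    rw [Int.cast_smul_eq_zsmul]; exact AddSubgroup.zsmul_mem _ (C.mem i) _

lemma natCast_smul_mem {z : W} (hz : z ∈ M) (t : ℕ) : (t : ℝ) • z ∈ M := by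
  rw [Nat.cast_smul_eq_nsmul]; exact AddSubgroup.nsmul_mem _ hz _

/-- A lattice vector of height strictly between `-1` and `1` has height zero. -/
lemma Config.ht_eq_zero (C : Config a M ht) {z : W} (hz : z ∈ M) (h : |ht z| < 1) : ht z = 0 := by
  obtain ⟨t, h'⟩ := C.ht_int z hz
  rw [h'] at h ⊢
  have : |t| < 1 := by exact_mod_cast h
  rw [Int.abs_lt_one_iff.1 this, Int.cast_zero]

lemma BoundedConfig.eq_zero_of_shift (C : BoundedConfig a M ht N d k) {x z : W}
    (hx : IsMinPoint a M ht N d x) (hz : z ∈ M) (hz0 : |ht z| < 1)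
    (h : ∀ t : ℕ, t ≤ k → InInt a (x + (t : ℝ) • z)) : z = 0 := by
  by_contra hne
  have h0 := C.ht_eq_zero hz hz0
  refine C.few (fun t => x + (t : ℝ) • z) (fun t ht' => ⟨AddSubgroup.add_mem _ hx.mem
    (natCast_smul_mem hz t), h t ht', ?_⟩) ?_
  · simp [h0, hx.height]
  · intro t _ t' _ htt
    have : ((t : ℝ) - t') • z = 0 := by
      rw [sub_smul, sub_eq_zero]; exact add_left_cancel htt
    rcases smul_eq_zero.1 this with h' | h'
    · exact_mod_cast sub_eq_zero.1 h'
    · exact absurd h' hne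

/-- The height bound applied to the representative of `z` in a half-open box. -/
lemma BoundedConfig.le_sum_round (C : BoundedConfig a M ht N d k) (h : IsBase a B) {z : W}
    (hz : z ∈ M) : (N : ℝ) ≤ ∑ j ∈ B, (coord a B z j - ⌈coord a B z j⌉ + 1) + d := by
  set e : ι → ℤ := fun j => if j ∈ B then ⌈coord a B z j⌉ - 1 else 0 with he
  have hce : coord a B (∑ j, (e j : ℝ) • a j) = fun j => (e j : ℝ) :=
    h.isCoord.apply_sum _ fun j hj => by simp [he, hj]
  have hmem : z - ∑ j, (e j : ℝ) • a j ∈ M := AddSubgroup.sub_mem _ hz (C.sum_mem e)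
  have hco : ∀ j ∈ B, coord a B (z - ∑ j, (e j : ℝ) • a j) j =
      coord a B z j - ⌈coord a B z j⌉ + 1 := by
    intro j hj
    rw [map_sub, Pi.sub_apply, hce]
    simp only [he, if_pos hj]
    push_cast
    ring
  have := C.int_height _ hmem (InInt.of_coord_pos h fun j hj => by
    rw [hco j hj]
    linarith [Int.ceil_lt_add_one (coord a B z j)])
  rwa [← C.sum_coord h, Finset.sum_congr rfl hco] at this

open Classical in
/-- Every lattice point has at most `2 * d` nonintegral coordinates. -/
lemma BoundedConfig.card_nonInt_le (C : BoundedConfig a M ht N d k) (h : IsBase a B) {z : W}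
    (hz : z ∈ M) : (B.filter fun j => NonInt (coord a B z j)).card ≤ 2 * d := by
  have h1 := C.le_sum_round h hz
  have h2 := C.le_sum_round h (neg_mem hz)
  have h3 : ∀ r : ℝ, (r - ⌈r⌉ + 1) + (-r - ⌈-r⌉ + 1) = 2 - if NonInt r then 1 else 0 := by
    intro r
    rw [Int.ceil_neg]
    split_ifs with hr
    · have : ⌈r⌉ = ⌊r⌋ + 1 := by
        rw [Int.ceil_eq_iff]
        push_cast
        refine ⟨?_, (Int.lt_floor_add_one r).le⟩
        have h1 := Int.floor_le r
        rcases h1.lt_or_eq with h1 | h1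
        · linarith
        · exact absurd ⟨_, h1.symm⟩ hr
      rw [this]; push_cast; ring
    · obtain ⟨t, rfl⟩ := not_not.1 hr
      simp
      ring
  have h4 : ∑ j ∈ B, (coord a B z j - ⌈coord a B z j⌉ + 1) +
      ∑ j ∈ B, (coord a B (-z) j - ⌈coord a B (-z) j⌉ + 1) =
      2 * N - (B.filter fun j => NonInt (coord a B z j)).card := by
    rw [← Finset.sum_add_distrib]
    simp only [map_neg, Pi.neg_apply, h3, Finset.sum_sub_distrib, Finset.sum_const,
      C.card_base B h, Finset.sum_boole]
    simp [mul_comm]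
  have h5 : ((B.filter fun j => NonInt (coord a B z j)).card : ℝ) ≤ 2 * d := by linarith
  exact_mod_cast h5

open Classical in
/-- The positions at which some lattice point has a nonintegral coordinate. -/
def fracSupport (a : ι → W) (M : AddSubgroup W) (B : Finset ι) : Finset ι :=
  B.filter fun j => ∃ z ∈ M, NonInt (coord a B z j)

lemma fracSupport_subset : fracSupport a M B ⊆ B := by
  classical exact Finset.filter_subset _ _

lemma exists_int_of_notMem_fracSupport (h : IsBase a B) {j : ι} (hj : j ∉ fracSupport a M B)
    {z : W} (hz : z ∈ M) : ∃ t : ℤ, coord a B z j = t := by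
  classical
  by_cases hjB : j ∈ B
  · by_contra hcon
    exact hj (Finset.mem_filter.2 ⟨hjB, z, hz, hcon⟩)
  · exact ⟨0, by rw [h.isCoord.apply_of_notMem z j hjB, Int.cast_zero]⟩

lemma BoundedConfig.card_fracSupport_le (C : BoundedConfig a M ht N d k) (h : IsBase a B) :
    (fracSupport a M B).card ≤ 4 * d := by
  classical
  set E := fracSupport a M B with hE
  have hz : ∀ j ∈ E, ∃ z ∈ M, NonInt (coord a B z j) := fun j hj => (Finset.mem_filter.1 hj).2
  choose! z hzM hz using hz
  let S : Finset ι → W := fun T => ∑ l ∈ T, z l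
  have hSM : ∀ T ∈ E.powerset, S T ∈ M := fun T hT =>
    AddSubgroup.sum_mem _ fun l hl => hzM l (Finset.mem_powerset.1 hT hl)
  have hhalf : ∀ j ∈ E, 2 ^ E.card ≤
      2 * (E.powerset.filter fun T => NonInt (coord a B (S T) j)).card := by
    intro j hj
    have h1 := Finset.card_filter_add_card_filter_not (s := E.powerset)
      (fun T => NonInt (coord a B (S T) j))
    rw [Finset.card_powerset] at h1
    have h2 : (E.powerset.filter fun T => ¬ NonInt (coord a B (S T) j)).card ≤
        (E.powerset.filter fun T => NonInt (coord a B (S T) j)).card := by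
      refine Finset.card_le_card_of_injOn (fun T => symmDiff T {j}) ?_
        (fun T _ T' _ hTT => symmDiff_left_injective _ hTT)
      intro T hT
      rw [Finset.mem_coe, Finset.mem_filter, Finset.mem_powerset, NonInt] at hT ⊢
      obtain ⟨hTE, hT⟩ := hT
      obtain ⟨t, hT⟩ := not_not.1 hT
      refine ⟨fun l hl => ?_, ?_⟩
      · rcases Finset.mem_symmDiff.1 hl with h | h
        · exact hTE h.1
        · rw [Finset.mem_singleton.1 h.1]; exact hj
      · rintro ⟨t', ht'⟩
        beta_reduce at ht'
        by_cases hjT : j ∈ T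
        · have h3 : symmDiff T {j} = T.erase j := by
            ext l
            simp only [Finset.mem_symmDiff, Finset.mem_singleton, Finset.mem_erase]
            constructor
            · rintro (h | ⟨rfl, h⟩)
              · exact ⟨h.2, h.1⟩
              · exact absurd hjT h
            · exact fun h => Or.inl ⟨h.2, h.1⟩
          have h4 : S T = S (T.erase j) + z j := (Finset.sum_erase_add T z hjT).symm
          rw [h3] at ht'
          rw [h4, map_add, Pi.add_apply, ht'] at hT
          exact hz j hj ⟨t - t', by push_cast; linarith⟩
        · have h3 : symmDiff T {j} = insert j T := by
            ext l
            simp only [Finset.mem_symmDiff, Finset.mem_singleton, Finset.mem_insert]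
            constructor
            · rintro (h | h)
              · exact Or.inr h.1
              · exact Or.inl h.1
            · rintro (rfl | h)
              · exact Or.inr ⟨rfl, hjT⟩
              · exact Or.inl ⟨h, by rintro rfl; exact hjT h⟩
          have h4 : S (insert j T) = z j + S T := Finset.sum_insert hjT
          rw [h3, h4, map_add, Pi.add_apply, hT] at ht'
          exact hz j hj ⟨t' - t, by push_cast; linarith⟩
    omega
  have hdouble : ∑ j ∈ E, (E.powerset.filter fun T => NonInt (coord a B (S T) j)).card =
      ∑ T ∈ E.powerset, (E.filter fun j => NonInt (coord a B (S T) j)).card := by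
    simp only [Finset.card_filter]
    exact Finset.sum_comm
  have hle : ∑ T ∈ E.powerset, (E.filter fun j => NonInt (coord a B (S T) j)).card ≤
      2 ^ E.card * (2 * d) := by
    rw [← Finset.card_powerset, ← smul_eq_mul]
    refine Finset.sum_le_card_nsmul _ _ _ fun T hT => ?_
    exact (Finset.card_le_card (Finset.filter_subset_filter _ (Finset.filter_subset _ _))).trans
      (C.card_nonInt_le h (hSM T hT))
  have hge : E.card * 2 ^ E.card ≤ 2 * ∑ j ∈ E,
      (E.powerset.filter fun T => NonInt (coord a B (S T) j)).card := by
    rw [Finset.mul_sum, ← smul_eq_mul]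
    exact Finset.card_nsmul_le_sum _ _ _ hhalf
  have : E.card * 2 ^ E.card ≤ (4 * d) * 2 ^ E.card := by
    rw [hdouble] at hge
    linarith
  exact Nat.le_of_mul_le_mul_right this (by positivity)

/-- Every linear functional on relations saves at most `d` generators. -/
lemma BoundedConfig.card_neg_le (C : BoundedConfig a M ht N d k) (h : IsBase a B) (μ : ι → ℝ) :
    (B.filter fun v => ∑ i, μ i * coord a B (a i) v < 0).card ≤
      (Finset.univ.filter fun i => μ i < 0).card + d := by
  set g : ι → ℝ := fun v => ∑ i, μ i * coord a B (a i) v with hg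
  have hgc : coord a B (∑ i, μ i • a i) = g := by
    ext v; rw [coord_sum]
  have hg0 : ∀ v ∉ B, g v = 0 := fun v hv => by
    rw [← hgc, h.isCoord.apply_of_notMem _ v hv]
  have hsum : ∑ i, μ i • a i = ∑ v, g v • a v := by
    rw [← hgc, h.isCoord.sum_apply]
  let ind : ι → ℝ := fun v => if v ∈ B ∧ 0 ≤ g v then 1 else 0
  let neg : ι → ℝ := fun v => if μ v < 0 then 1 else 0
  -- an interior point supported on the kept basis elements and the negative part of `μ`
  let e : ι → ℝ := fun v => ind v * (g v + 1) + neg v * (- μ v)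
  have hy : InInt a (∑ v, e v • a v) := by
    have h1 : ∑ v, e v • a v = ∑ v, (ind v * (g v + 1) - g v) • a v +
        ∑ v, (μ v + neg v * (- μ v)) • a v := by
      have : ∀ v, e v • a v = (ind v * (g v + 1) - g v) • a v +
          (μ v + neg v * (- μ v)) • a v + (g v • a v - μ v • a v) := by
        intro v; simp only [e, ← add_smul, ← sub_smul]; ring_nf
      simp only [this, Finset.sum_add_distrib, Finset.sum_sub_distrib, hsum, sub_self, add_zero]
    rw [h1]
    refine InInt.add (InInt.of_coord_pos h fun v hv => ?_) ⟨_, fun v => ?_, rfl⟩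
    · rw [h.isCoord.apply_sum _ fun v hv => by simp [ind, hv, hg0 v hv]]
      by_cases hgv : 0 ≤ g v
      · simp [ind, hv, hgv]
      · simp only [ind, hv, hgv, and_false, if_false, zero_mul, zero_sub, neg_pos]
        exact not_le.1 hgv
    · by_cases hv : μ v < 0
      · simp [neg, hv]
      · simp only [neg, hv, if_false, zero_mul, add_zero]
        exact not_lt.1 hv
  have hind : ∀ v, ind v = 0 ∨ ind v = 1 := fun v => by
    simp only [ind]; split_ifs <;> simp
  have hneg : ∀ v, neg v = 0 ∨ neg v = 1 := fun v => by
    simp only [neg]; split_ifs <;> simp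
  have hz : InInt a (∑ v, (ind v + neg v) • a v) := by
    refine hy.of_support rfl (fun v => ?_) fun v hv => ?_
    · rcases hind v with h | h <;> rcases hneg v with h' | h' <;> rw [h, h'] <;> norm_num
    · rcases hind v with h | h <;> rcases hneg v with h' | h' <;> simp [e, h, h'] at hv ⊢
  have hzM : ∑ v, (ind v + neg v) • a v ∈ M := by
    convert C.sum_mem (fun v => (if v ∈ B ∧ 0 ≤ g v then 1 else 0) + if μ v < 0 then 1 else 0)
      using 3 with v
    push_cast
    rfl
  have hht := C.int_height _ hzM hz
  rw [C.ht_sum, Finset.sum_add_distrib] at hht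
  have h1 : ∑ v, ind v = (B.filter fun v => 0 ≤ g v).card := by
    simp only [ind, Finset.sum_boole]
    congr 2
    ext v; simp
  have h2 : ∑ v, neg v = (Finset.univ.filter fun i => μ i < 0).card := by
    simp only [neg, Finset.sum_boole]
  have h3 : (B.filter fun v => 0 ≤ g v).card + (B.filter fun v => g v < 0).card = N := by
    rw [← C.card_base B h, ← Finset.card_filter_add_card_filter_not (s := B) (fun v => 0 ≤ g v)]
    simp only [not_le]
  rw [h1, h2, ← h3] at hht
  have : (B.filter fun v => g v < 0).card ≤
    (Finset.univ.filter fun i => μ i < 0).card + d := by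
      have : ((B.filter fun v => g v < 0).card : ℝ) ≤
        (Finset.univ.filter fun i => μ i < 0).card + d := by push_cast at hht; linarith
      exact_mod_cast this
  exact this

lemma BoundedConfig.card_support_le (C : BoundedConfig a M ht N d k) (h : IsBase a B) (i : ι) :
    (B.filter fun v => coord a B (a i) v ≠ 0).card ≤ 2 * d + 1 := by
  have h1 := C.card_neg_le h (Pi.single i 1)
  have h2 := C.card_neg_le h (Pi.single i (-1))
  have e1 : (Finset.univ.filter fun l => (Pi.single i 1 : ι → ℝ) l < 0) = ∅ := by
    ext l; by_cases hl : l = i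
    · subst hl; simp
    · simp [hl]
  have e2 : (Finset.univ.filter fun l => (Pi.single i (-1) : ι → ℝ) l < 0) = {i} := by
    ext l; by_cases hl : l = i
    · subst hl; simp
    · simp [hl]
  rw [e1] at h1
  rw [e2] at h2
  simp only [Pi.single_apply, ite_mul, zero_mul, Finset.sum_ite_eq', Finset.mem_univ, if_true,
    one_mul, neg_mul, Finset.card_empty, Finset.card_singleton, Left.neg_neg_iff] at h1 h2
  have : (B.filter fun v => coord a B (a i) v ≠ 0) =
      (B.filter fun v => coord a B (a i) v < 0) ∪ B.filter fun v => 0 < coord a B (a i) v := by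
    rw [← Finset.filter_or]
    exact Finset.filter_congr fun v _ => lt_or_lt_iff_ne.symm
  rw [this]
  exact (Finset.card_union_le _ _).trans (by omega)

end LatticeCone

namespace LatticeCone

set_option linter.unusedSectionVars false

section

variable {ι W : Type*} [Fintype ι] [DecidableEq ι] [AddCommGroup W] [Module ℝ W]
  {a : ι → W} {B : Finset ι} {M : AddSubgroup W} {ht : W →ₗ[ℝ] ℝ} {N d k : ℕ}

end

/-- A minimal interior point has, for every generator, a representation in which the coefficient
of this generator is bounded below in terms of `d` and `k` only. -/
lemma exists_coeff_lower_bound (d k : ℕ) : ∃ ε : ℝ, 0 < ε ∧ ε ≤ 1 ∧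
    ∀ {ι W : Type} [Fintype ι] [DecidableEq ι] [AddCommGroup W] [Module ℝ W] {a : ι → W}
      {M : AddSubgroup W} {ht : W →ₗ[ℝ] ℝ} {N : ℕ} {x : W}, BoundedConfig a M ht N d k →
      IsMinPoint a M ht N d x →
      ∀ i, ∃ c : ι → ℝ, (∀ j, 0 ≤ c j) ∧ ∑ j, c j • a j = x ∧ ε ≤ c i := by
  classical
  obtain ⟨ε, hε, H⟩ := exists_gap_approx (2 * d) ((k + 1) * (2 * d + 1))
  refine ⟨min ε 1, lt_min hε one_pos, min_le_right _ _, ?_⟩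
  intro ι W _ _ _ _ a M ht N x C hx i
  obtain ⟨B, hB, hβ0, hβi⟩ := C.exists_base_of_inInt hx.inInt i
  set β := coord a B x with hβ
  refine ⟨β, hβ0, hB.isCoord.sum_apply x, ?_⟩
  by_contra! hlt
  set J := B.filter fun j => NonInt (β j) with hJ
  have hJpos : ∀ j ∈ J, 0 < β j := fun j hj => by
    refine (hβ0 j).lt_of_ne' fun h0 => (Finset.mem_filter.1 hj).2 ⟨0, by simpa using h0⟩
  have hiJ : i ∈ J := by
    refine Finset.mem_filter.2 ⟨?_, ?_⟩
    · by_contra hi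
      rw [hβ, hB.isCoord.apply_of_notMem x i hi] at hβi
      exact lt_irrefl _ hβi
    · rintro ⟨t, ht'⟩
      have h1 := lt_of_lt_of_le hlt (min_le_right ε 1)
      rw [ht'] at h1 hβi
      have h1 : t < 1 := by exact_mod_cast h1
      have h2 : 0 < t := by exact_mod_cast hβi
      omega
  obtain ⟨m, b, hm, hbi, hb⟩ := H J β (C.card_nonInt_le hB hx.mem) hJpos i hiJ
    (lt_of_lt_of_le hlt (min_le_left _ _))
  have hint : ∀ j, ∃ t : ℤ, j ∉ J → β j = t := by
    intro j
    by_cases hj : j ∈ J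
    · exact ⟨0, fun h => absurd hj h⟩
    · by_cases hjB : j ∈ B
      · have : ∃ t : ℤ, β j = t := by
          by_contra hcon
          exact hj (Finset.mem_filter.2 ⟨hjB, hcon⟩)
        exact this.imp fun t ht' _ => ht'
      · exact ⟨0, fun _ => by rw [hβ, hB.isCoord.apply_of_notMem x j hjB, Int.cast_zero]⟩
  choose τ hτ using hint
  set e : ι → ℤ := fun j => if j ∈ J then b j else m * τ j with he
  set g : ι → ℝ := fun j => m * β j - e j with hg
  have hgJ : ∀ j ∉ J, g j = 0 := fun j hj => by
    simp only [hg, he, if_neg hj]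
    push_cast
    rw [← hτ j hj, sub_self]
  have hgb : ∀ j ∈ J, g j = m * β j - b j := fun j hj => by simp only [hg, he, if_pos hj]
  have hsum : ∑ j, g j • a j = (m : ℝ) • x - ∑ j, (e j : ℝ) • a j := by
    simp only [hg, sub_smul, Finset.sum_sub_distrib, mul_smul]
    rw [← Finset.smul_sum, hB.isCoord.sum_apply]
  have hmem : ∑ j, g j • a j ∈ M := by
    rw [hsum]; exact AddSubgroup.sub_mem _ (natCast_smul_mem hx.mem m) (C.sum_mem e)
  have hzero : ∑ j, g j • a j = 0 := by
    refine C.eq_zero_of_shift hx hmem ?_ fun t htk => ?_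
    · rw [C.ht_sum, ← Finset.sum_subset (Finset.subset_univ J) fun j _ hj => hgJ j hj]
      have hcard : (J.card : ℝ) < 2 * d + 1 := by
        have : J.card ≤ 2 * d := C.card_nonInt_le hB hx.mem
        have : J.card < 2 * d + 1 := by omega
        exact_mod_cast this
      have h1 : ∑ j ∈ J, (((k + 1) * (2 * d + 1) : ℕ) : ℝ) * |g j| ≤ J.card := by
        rw [Finset.cast_card]
        refine Finset.sum_le_sum fun j hj => ?_
        rw [hgb j hj]; exact (hb j hj).2.le
      rw [← Finset.mul_sum] at h1
      have h2 := Finset.abs_sum_le_sum_abs g J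
      have h3 : 0 ≤ ∑ j ∈ J, |g j| := Finset.sum_nonneg fun j _ => abs_nonneg _
      push_cast at h1
      have hk : (0 : ℝ) ≤ k := k.cast_nonneg
      have hd : (0 : ℝ) ≤ d := d.cast_nonneg
      nlinarith [mul_nonneg (mul_nonneg hk (by positivity : (0 : ℝ) ≤ 2 * d + 1)) h3]
    · have hx' : x + (t : ℝ) • ∑ j, g j • a j = ∑ j, (β j + t * g j) • a j := by
        simp only [add_smul, Finset.sum_add_distrib, mul_smul,
          Finset.smul_sum]
        rw [hβ, hB.isCoord.sum_apply]
      have hJt : ∀ j ∈ J, 0 < β j + t * g j := by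
        intro j hj
        have h1 := (hb j hj).1
        rw [hgb j hj]
        have h2 := hJpos j hj
        have h3 : (t : ℝ) ≤ ((k + 1) * (2 * d + 1) : ℕ) := by
          exact_mod_cast htk.trans (by nlinarith)
        rcases le_total 0 (m * β j - b j) with h4 | h4
        · positivity
        · nlinarith
      rw [hx']
      refine hx.inInt.of_support (hB.isCoord.sum_apply x) (fun j => ?_) fun j hj => ?_
      · by_cases hj : j ∈ J
        · exact (hJt j hj).le
        · rw [hgJ j hj, mul_zero, add_zero]; exact hβ0 j
      · by_cases hjJ : j ∈ J
        · exact hJt j hjJ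
        · rw [hgJ j hjJ, mul_zero, add_zero]; exact (hβ0 j).lt_of_ne' hj
  have h1 : coord a B (∑ j, g j • a j) = g := hB.isCoord.apply_sum g fun j hj =>
    hgJ j fun h => hj (Finset.mem_filter.1 h).1
  rw [hzero, map_zero] at h1
  have h2 : g i = m * β i := by rw [hgb i hiJ, hbi, Int.cast_zero, sub_zero]
  rw [← h1, Pi.zero_apply] at h2
  have : 0 < (m : ℝ) * β i := by positivity
  linarith

/-- Generators are well distributed over the representations of the minimal point `x`. -/
structure SpreadConfig {ι W : Type} [Fintype ι] [DecidableEq ι] [AddCommGroup W] [Module ℝ W]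
    (a : ι → W) (M : AddSubgroup W) (ht : W →ₗ[ℝ] ℝ) (N d k : ℕ) (ε : ℝ) (x : W) : Prop
    extends BoundedConfig a M ht N d k where
  inj : Function.Injective a
  minPoint : IsMinPoint a M ht N d x
  coeff : ∀ i, ∃ c : ι → ℝ, (∀ j, 0 ≤ c j) ∧ ∑ j, c j • a j = x ∧ ε ≤ c i

variable {ι W : Type} [Fintype ι] [DecidableEq ι] [AddCommGroup W] [Module ℝ W]
  {a : ι → W} {B : Finset ι} {M : AddSubgroup W} {ht : W →ₗ[ℝ] ℝ} {N d k : ℕ} {ε : ℝ} {x : W}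

/-- Lattice vectors with few, small coefficients vanish. -/
lemma SpreadConfig.eq_zero_of_small (C : SpreadConfig a M ht N d k ε x) (hε1 : ε ≤ 1)
    {U : Finset ι} {s : ι → ℝ} (hU : ∀ i ∉ U, s i = 0)
    (hs : ∀ i ∈ U, |s i| * (2 * (k + 1) * (U.card + 1)) < ε) (hM : ∑ i, s i • a i ∈ M) :
    ∑ i, s i • a i = 0 := by
  choose c hc0 hcx hc using C.coeff
  obtain ⟨p, hp, hpx⟩ := C.minPoint.inInt
  refine C.eq_zero_of_shift C.minPoint hM ?_ fun t htk => ?_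
  · rw [C.ht_sum, ← Finset.sum_subset (Finset.subset_univ U) fun j _ hj => hU j hj]
    have h1 : ∑ i ∈ U, |s i| * (2 * (k + 1) * (U.card + 1)) ≤ U.card * ε := by
      rw [← nsmul_eq_mul]; exact Finset.sum_le_card_nsmul _ _ _ fun i hi => (hs i hi).le
    rw [← Finset.sum_mul] at h1
    have h2 := Finset.abs_sum_le_sum_abs s U
    have h3 : 0 ≤ ∑ j ∈ U, |s j| := Finset.sum_nonneg fun j _ => abs_nonneg _
    have hk : (0 : ℝ) ≤ k := k.cast_nonneg
    have hd : (0 : ℝ) ≤ U.card := U.card.cast_nonneg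
    have h5 : (∑ j ∈ U, |s j|) * (U.card + 1) ≤ U.card := by
      nlinarith [mul_nonneg (mul_nonneg hk h3) (by positivity : (0 : ℝ) ≤ U.card + 1),
        mul_nonneg h3 (by positivity : (0 : ℝ) ≤ U.card + 1)]
    have h6 : ∑ j ∈ U, |s j| < 1 := by
      by_contra! hcon
      nlinarith
    linarith
  · set u : ℝ := 2 * (U.card + 1) with hu
    have hu0 : 0 < u := by positivity
    -- distribute half of `x` over the representations `c i`, `i ∈ U`
    have hrep : x + (t : ℝ) • ∑ i, s i • a i =
        ∑ j, (p j / 2 + ((1 / u) * p j + ∑ i ∈ U, (1 / u) * c i j + t * s j)) • a j := by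
      simp only [add_smul, Finset.sum_add_distrib, mul_smul, Finset.sum_smul, div_eq_inv_mul]
      rw [Finset.sum_comm]
      simp only [← Finset.smul_sum, hpx, hcx, Finset.sum_const]
      have : (2 : ℝ)⁻¹ + u⁻¹ + u⁻¹ * U.card = 1 := by
        rw [hu]; field_simp; ring
      rw [← Nat.cast_smul_eq_nsmul ℝ]
      conv_lhs => rw [← one_smul ℝ x, ← this]
      module
    rw [hrep]
    refine ⟨_, fun j => ?_, rfl⟩
    have h1 : 0 < p j := hp j
    have h2 : 0 ≤ ∑ i ∈ U, (1 / u) * c i j :=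
      Finset.sum_nonneg fun i _ => mul_nonneg (by positivity) (hc0 i j)
    have h3 : 0 < (1 / u) * p j := by positivity
    by_cases hj : j ∈ U
    · have h4 : (1 / u) * c j j ≤ ∑ i ∈ U, (1 / u) * c i j :=
        Finset.single_le_sum (f := fun i => (1 / u) * c i j)
          (fun i _ => mul_nonneg (by positivity) (hc0 i j)) hj
      have h5 : |t * s j| ≤ (1 / u) * c j j := by
        rw [abs_mul, Nat.abs_cast, one_div, inv_mul_eq_div, le_div_iff₀ hu0]
        have h6 := hs j hj
        have h7 : (t : ℝ) ≤ k + 1 := by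
          have : (t : ℝ) ≤ k := by exact_mod_cast htk
          linarith
        calc (t : ℝ) * |s j| * u ≤ (k + 1) * |s j| * u := by gcongr
          _ = |s j| * (2 * (k + 1) * (U.card + 1)) := by rw [hu]; ring
          _ ≤ c j j := h6.le.trans (hc j)
      have := neg_abs_le ((t : ℝ) * s j)
      linarith
    · rw [hU j hj, mul_zero]
      linarith

end LatticeCone

namespace LatticeCone

variable {ι W : Type} [Fintype ι] [DecidableEq ι] [AddCommGroup W] [Module ℝ W]
  {a : ι → W} {B : Finset ι} {M : AddSubgroup W} {ht : W →ₗ[ℝ] ℝ} {N d k : ℕ} {ε : ℝ} {x : W}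

/-- Lattice points with the same coordinates outside a small set `E` and nearly the same
coordinates on `E` are equal. -/
lemma SpreadConfig.eq_of_close (C : SpreadConfig a M ht N d k ε x) (hε1 : ε ≤ 1)
    (h : IsBase a B) {E : Finset ι} {D m : ℕ} (hE : E.card ≤ D)
    (hm : 2 * (k + 1) * (D + 1) ≤ ε * m) {y z : W} (hy : y ∈ M) (hz : z ∈ M)
    (hoff : ∀ j ∉ E, coord a B y j = coord a B z j)
    (hon : ∀ j ∈ E, |m * coord a B y j - m * coord a B z j| < 1) : y = z := by
  rw [← sub_eq_zero, ← h.isCoord.sum_apply (y - z)]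
  have hm0 : 0 < ε * m := lt_of_lt_of_le (by positivity) hm
  have hε : 0 < ε := pos_of_mul_pos_left hm0 m.cast_nonneg
  refine C.eq_zero_of_small hε1 (U := E) (fun j hj => ?_) (fun j hj => ?_) ?_
  · rw [map_sub, Pi.sub_apply, hoff j hj, sub_self]
  · have h1 := hon j hj
    rw [map_sub, Pi.sub_apply]
    rw [← mul_sub, abs_mul, Nat.abs_cast] at h1
    have hE' : (E.card : ℝ) ≤ D := by exact_mod_cast hE
    calc |coord a B y j - coord a B z j| * (2 * (k + 1) * (E.card + 1))
        ≤ |coord a B y j - coord a B z j| * (ε * m) := by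
          refine mul_le_mul_of_nonneg_left (le_trans ?_ hm) (abs_nonneg _)
          gcongr
      _ = ε * (m * |coord a B y j - coord a B z j|) := by ring
      _ < ε * 1 := by gcongr
      _ = ε := mul_one ε
  · rw [h.isCoord.sum_apply]; exact AddSubgroup.sub_mem _ hy hz

/-- A translated open box spanned by a base contains few lattice points. -/
lemma SpreadConfig.card_box_le (C : SpreadConfig a M ht N d k ε x) (hε1 : ε ≤ 1)
    (h : IsBase a B) {m : ℕ} (hm : 2 * (k + 1) * ((4 * d : ℕ) + 1) ≤ ε * m) (s : W)
    (S : Finset W) (hS : ∀ p ∈ S, p ∈ M)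
    (hbox : ∀ p ∈ S, ∀ j ∈ B, 0 < coord a B (p + s) j ∧ coord a B (p + s) j < 1) :
    S.card ≤ m ^ (4 * d) := by
  have hm0 : 0 < m := by
    rcases Nat.eq_zero_or_pos m with rfl | h0
    · have : (0 : ℝ) < 2 * (k + 1) * ((4 * d : ℕ) + 1) := by positivity
      simp at hm; push_cast at this; linarith
    · exact h0
  set E := fracSupport a M B with hE
  have hEB : E ⊆ B := fracSupport_subset
  have hcard : E.card ≤ 4 * d := C.card_fracSupport_le h
  have hfloor : ∀ p ∈ S, ∀ j ∈ E, 0 ≤ ⌊m * coord a B (p + s) j⌋ ∧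
      ⌊m * coord a B (p + s) j⌋ < m := by
    intro p hp j hj
    obtain ⟨h1, h2⟩ := hbox p hp j (hEB hj)
    refine ⟨Int.floor_nonneg.2 (by positivity), Int.floor_lt.2 ?_⟩
    have : (0 : ℝ) < m := by exact_mod_cast hm0
    push_cast
    nlinarith
  let f : W → E → Fin m := fun p j =>
    ⟨⌊m * coord a B (p + s) j⌋.toNat % m, Nat.mod_lt _ hm0⟩
  have hinj : Set.InjOn f S := by
    intro p hp q hq hpq
    refine C.eq_of_close hε1 h hcard hm (hS p hp) (hS q hq) (fun j hj => ?_) fun j hj => ?_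
    · by_cases hjB : j ∈ B
      · obtain ⟨t, h1⟩ := exists_int_of_notMem_fracSupport h hj (hS p hp)
        obtain ⟨t', h2⟩ := exists_int_of_notMem_fracSupport h hj (hS q hq)
        have h3 := hbox p hp j hjB
        have h4 := hbox q hq j hjB
        rw [map_add, Pi.add_apply, h1] at h3
        rw [map_add, Pi.add_apply, h2] at h4
        have h5 : (t : ℝ) < t' + 1 := by linarith
        have h6 : (t' : ℝ) < t + 1 := by linarith
        rw [h1, h2]
        have h5 : t < t' + 1 := by exact_mod_cast h5
        have h6 : t' < t + 1 := by exact_mod_cast h6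
        congr 1; omega
      · rw [h.isCoord.apply_of_notMem _ j hjB, h.isCoord.apply_of_notMem _ j hjB]
    · have h1 := congrArg Fin.val (congrFun hpq ⟨j, hj⟩)
      have h2 := hfloor p hp j hj
      have h3 := hfloor q hq j hj
      simp only [f] at h1
      rw [Nat.mod_eq_of_lt (by omega), Nat.mod_eq_of_lt (by omega)] at h1
      have := Int.abs_sub_lt_one_of_floor_eq_floor (show ⌊m * coord a B (p + s) j⌋ =
        ⌊m * coord a B (q + s) j⌋ by omega)
      rw [map_add, map_add, Pi.add_apply, Pi.add_apply] at this
      rwa [mul_add, mul_add, add_sub_add_right_eq_sub] at this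
  have h1 := Finset.card_le_card_of_injOn (t := Finset.univ) f (fun _ _ => Finset.mem_univ _) hinj
  rw [Finset.card_univ, Fintype.card_fun, Fintype.card_fin, Fintype.card_coe] at h1
  exact h1.trans (Nat.pow_le_pow_right hm0 hcard)

section

variable {ι W : Type*} [Fintype ι] [DecidableEq ι] [AddCommGroup W] [Module ℝ W]
  {a : ι → W} {B : Finset ι} {M : AddSubgroup W} {ht : W →ₗ[ℝ] ℝ}

/-- There is a base such that all generators have coordinates bounded by one. -/
lemma Config.exists_base_abs_le_one (C : Config a M ht) :
    ∃ B, IsBase a B ∧ ∀ i v, |coord a B (a i) v| ≤ 1 := by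
  classical
  obtain ⟨κ, b₀, hb₀, hs, hl⟩ := exists_linearIndependent' ℝ a
  have : Finite κ := Finite.of_injective b₀ hb₀
  have := Fintype.ofFinite κ
  rw [C.span] at hs
  let e : Module.Basis κ ℝ W := Module.Basis.mk hl hs.ge
  have he : ∀ l, e l = a (b₀ l) := fun l => by simp [e]
  obtain ⟨b, -, hb⟩ := Finset.exists_max_image (Finset.univ : Finset (κ → ι))
    (fun b => |e.det (a ∘ b)|) ⟨b₀, Finset.mem_univ _⟩
  have hpos : 0 < |e.det (a ∘ b)| := by
    refine lt_of_lt_of_le ?_ (hb b₀ (Finset.mem_univ _))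
    have : a ∘ b₀ = e := funext fun l => (he l).symm
    rw [this, e.det_self]
    norm_num
  obtain ⟨hli, hsp⟩ := (e.is_basis_iff_det).2 (isUnit_iff_ne_zero.2 (abs_pos.1 hpos))
  let e' : Module.Basis κ ℝ W := Module.Basis.mk hli hsp.ge
  have he' : ∀ l, e' l = a (b l) := fun l => by simp [e']
  obtain ⟨hB, hco⟩ := isBase_of_basis e' b he'
  refine ⟨_, hB, fun i v => ?_⟩
  by_cases hv : v ∈ Finset.univ.image b
  · obtain ⟨l, -, rfl⟩ := Finset.mem_image.1 hv
    have h1 := hb (Function.update b l i) (Finset.mem_univ _)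
    have h2 : a ∘ Function.update b l i = Function.update (a ∘ b) l (a i) := by
      rw [Function.comp_update]
    have h3 : a i = ∑ l', e'.repr (a i) l' • (a ∘ b) l' := by
      conv_lhs => rw [← e'.sum_repr (a i)]
      simp [he']
    have h4 : e.det (Function.update (a ∘ b) l (a i)) = e'.repr (a i) l * e.det (a ∘ b) := by
      conv_lhs => rw [h3]
      rw [e.det.map_update_sum]
      rw [Finset.sum_eq_single l]
      · rw [e.det.map_update_smul, Function.update_eq_self, smul_eq_mul]
      · intro l' _ hl'
        rw [e.det.map_update_smul, e.det.map_update_self _ hl'.symm, smul_zero]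
      · simp
    rw [h2, h4, abs_mul] at h1
    rw [hco]
    exact le_of_mul_le_mul_right (by linarith) hpos
  · rw [hB.isCoord.apply_of_notMem _ v hv]; norm_num

end

end LatticeCone

namespace LatticeCone

set_option linter.unusedSectionVars false

section

variable {ι W : Type*} [Fintype ι] [DecidableEq ι] [AddCommGroup W] [Module ℝ W]
  {a : ι → W} {B : Finset ι} {M : AddSubgroup W} {ht : W →ₗ[ℝ] ℝ} {N d k : ℕ}

/-- Modulo the span of `E`, every generator is zero or equal to one of the elements of the base. -/
def IsCayley (a : ι → W) (B E : Finset ι) : Prop :=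
  ∀ i, (∀ v ∉ E, coord a B (a i) v = 0) ∨
    ∃ v ∈ B \ E, ∀ u ∉ E, coord a B (a i) u = if u = v then 1 else 0

/-- Negative coordinates are produced faster than negative coefficients as long as the
family does not have Cayley structure. -/
lemma BoundedConfig.exists_isCayley_or (C : BoundedConfig a M ht N d k) (h : IsBase a B)
    (habs : ∀ i v, |coord a B (a i) v| ≤ 1) (r : ℕ) :
    (∃ E, fracSupport a M B ⊆ E ∧ E ⊆ B ∧ IsCayley a B E ∧
      E.card ≤ (fracSupport a M B).card + r * (2 * d + 1)) ∨
    ∃ (E : Finset ι) (μ : ι → ℝ), fracSupport a M B ⊆ E ∧ E ⊆ B ∧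
      E.card ≤ (fracSupport a M B).card + r * (2 * d + 1) ∧
      (∀ i, μ i ≠ 0 → ∀ v ∉ E, coord a B (a i) v = 0) ∧
      (Finset.univ.filter fun i => μ i < 0).card + r ≤
        (E.filter fun v => ∑ i, μ i * coord a B (a i) v < 0).card := by
  classical
  induction r with
  | zero => exact Or.inr ⟨_, 0, subset_rfl, fracSupport_subset, by simp, by simp, by simp⟩
  | succ r ih =>
    rcases ih with ⟨E, h1, h2, h3, h4⟩ | ⟨E, μ, h1, h2, h3, hμ, h5⟩
    · exact Or.inl ⟨E, h1, h2, h3, h4.trans (by gcongr; omega)⟩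
    by_cases hE : IsCayley a B E
    · exact Or.inl ⟨E, h1, h2, hE, h3.trans (by gcongr; omega)⟩
    right
    obtain ⟨i, hi⟩ := not_forall.1 hE
    obtain ⟨hi1, hi2⟩ := not_or.1 hi
    push Not at hi1 hi2
    have hval : ∀ v ∉ E, coord a B (a i) v = -1 ∨ coord a B (a i) v = 0 ∨
        coord a B (a i) v = 1 := by
      intro v hv
      obtain ⟨t, h'⟩ := exists_int_of_notMem_fracSupport h (fun hv' => hv (h1 hv')) (C.mem i)
      have h6 := habs i v
      rw [h'] at h6 ⊢
      have h6 : |t| ≤ 1 := by exact_mod_cast h6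
      rw [abs_le] at h6
      have : t = -1 ∨ t = 0 ∨ t = 1 := by omega
      rcases this with rfl | rfl | rfl <;> simp
    have hmemB : ∀ v, coord a B (a i) v ≠ 0 → v ∈ B := fun v hv => by
      by_contra hvB
      exact hv (h.isCoord.apply_of_notMem _ v hvB)
    have hF : ∃ (σ : ℝ) (F : Finset ι), (∀ v ∈ F, v ∉ E ∧ v ∈ B ∧ σ * coord a B (a i) v < 0) ∧
        (0 < σ ∧ 1 ≤ F.card ∨ 2 ≤ F.card) := by
      by_cases hneg : ∃ v ∉ E, coord a B (a i) v = -1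
      · obtain ⟨v, hv, hv1⟩ := hneg
        refine ⟨1, {v}, fun u hu => ?_, by simp⟩
        rw [Finset.mem_singleton.1 hu]
        exact ⟨hv, hmemB v (by rw [hv1]; norm_num), by rw [hv1]; norm_num⟩
      · push Not at hneg
        have hone : ∀ v ∉ E, coord a B (a i) v ≠ 0 → coord a B (a i) v = 1 := by
          intro v hv hv0
          rcases hval v hv with h | h | h
          · exact absurd h (hneg v hv)
          · exact absurd h hv0
          · exact h
        obtain ⟨v, hv, hv0⟩ := hi1
        have hv1 := hone v hv hv0
        obtain ⟨u, hu, hu1⟩ := hi2 v (Finset.mem_sdiff.2 ⟨hmemB v hv0, hv⟩)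
        have huv : u ≠ v := by
          rintro rfl
          rw [if_pos rfl] at hu1
          exact hu1 hv1
        rw [if_neg huv] at hu1
        have hu2 := hone u hu hu1
        refine ⟨-1, {u, v}, fun w hw => ?_, Or.inr (by rw [Finset.card_pair huv])⟩
        rcases Finset.mem_insert.1 hw with rfl | hw
        · exact ⟨hu, hmemB w hu1, by rw [hu2]; norm_num⟩
        · rw [Finset.mem_singleton.1 hw]
          exact ⟨hv, hmemB v hv0, by rw [hv1]; norm_num⟩
    obtain ⟨σ, F, hF, hFcard⟩ := hF
    set g : ι → ℝ := fun v => ∑ i, μ i * coord a B (a i) v with hg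
    obtain ⟨δ, hδ, hsm⟩ := exists_small (E.filter fun v => g v < 0) (fun v => - g v)
      (fun v => σ * coord a B (a i) v) (fun v hv => by
        have := (Finset.mem_filter.1 hv).2
        linarith)
    have hμi : μ i = 0 := by
      by_contra hne
      obtain ⟨v, hv, hv0⟩ := hi1
      exact hv0 (hμ i hne v hv)
    have hg0 : ∀ v ∉ E, g v = 0 := fun v hv => Finset.sum_eq_zero fun l _ => by
      by_cases hl : μ l = 0
      · rw [hl, zero_mul]
      · rw [hμ l hl v hv, mul_zero]
    have hg' : ∀ v, ∑ l, (μ + Pi.single i (δ * σ) : ι → ℝ) l * coord a B (a l) v =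
        g v + δ * (σ * coord a B (a i) v) := by
      intro v
      simp only [Pi.add_apply, add_mul, Finset.sum_add_distrib, Pi.single_apply, ite_mul, zero_mul,
        Finset.sum_ite_eq', Finset.mem_univ, if_true, hg, mul_assoc]
    refine ⟨E ∪ B.filter fun v => coord a B (a i) v ≠ 0, μ + Pi.single i (δ * σ),
      h1.trans Finset.subset_union_left, Finset.union_subset h2 (Finset.filter_subset _ _), ?_, ?_,
      ?_⟩
    · have h6 := Finset.card_union_le E (B.filter fun v => coord a B (a i) v ≠ 0)
      have h7 := C.card_support_le h i
      have : (r + 1) * (2 * d + 1) = r * (2 * d + 1) + (2 * d + 1) := by ring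
      omega
    · intro l hl v hv
      rw [Finset.mem_union, not_or] at hv
      by_cases hli : l = i
      · subst hli
        by_contra hne
        exact hv.2 (Finset.mem_filter.2 ⟨hmemB v hne, hne⟩)
      · exact hμ l (by simpa [hli] using hl) v hv.1
    · have hsub : (E.filter fun v => g v < 0) ∪ F ⊆
          (E ∪ B.filter fun v => coord a B (a i) v ≠ 0).filter fun v =>
            ∑ l, (μ + Pi.single i (δ * σ) : ι → ℝ) l * coord a B (a l) v < 0 := by
        intro v hv
        rw [Finset.mem_filter, hg' v, Finset.mem_union]
        rcases Finset.mem_union.1 hv with hv | hv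
        · exact ⟨Or.inl (Finset.mem_filter.1 hv).1, by linarith [hsm v hv]⟩
        · obtain ⟨h6, h7, h8⟩ := hF v hv
          refine ⟨Or.inr (Finset.mem_filter.2 ⟨h7, fun h0 => ?_⟩), ?_⟩
          · rw [h0, mul_zero] at h8; exact lt_irrefl _ h8
          · rw [hg0 v h6, zero_add]; exact mul_neg_of_pos_of_neg hδ h8
      change _ ≤ (E.filter fun v => g v < 0).card at h5
      have hdisj : Disjoint (E.filter fun v => g v < 0) F := Finset.disjoint_left.2 fun v hv hv' =>
        (hF v hv').1 (Finset.mem_filter.1 hv).1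
      have h6 := Finset.card_le_card hsub
      rw [Finset.card_union_of_disjoint hdisj] at h6
      have hsub2 : (Finset.univ.filter fun l => (μ + Pi.single i (δ * σ) : ι → ℝ) l < 0) ⊆
          insert i (Finset.univ.filter fun l => μ l < 0) := by
        intro l hl
        by_cases hli : l = i
        · simp [hli]
        · rw [Finset.mem_filter] at hl
          simpa [hli] using hl
      have h7 := (Finset.card_le_card hsub2).trans (Finset.card_insert_le _ _)
      rcases hFcard with ⟨hσ, hF1⟩ | hF2
      · have hsub3 : (Finset.univ.filter fun l => (μ + Pi.single i (δ * σ) : ι → ℝ) l < 0) ⊆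
            Finset.univ.filter fun l => μ l < 0 := by
          intro l hl
          by_cases hli : l = i
          · subst hli
            have h8 := (Finset.mem_filter.1 hl).2
            simp only [Pi.add_apply, hμi, Pi.single_eq_same, zero_add] at h8
            exact absurd h8 (not_lt.2 (by positivity))
          · rw [Finset.mem_filter] at hl
            simpa [hli] using hl
        have h8 := Finset.card_le_card hsub3
        omega
      · omega

lemma BoundedConfig.exists_isCayley (C : BoundedConfig a M ht N d k) (h : IsBase a B)
    (habs : ∀ i v, |coord a B (a i) v| ≤ 1) :
    ∃ E, fracSupport a M B ⊆ E ∧ E ⊆ B ∧ IsCayley a B E ∧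
      E.card ≤ 4 * d + (d + 1) * (2 * d + 1) := by
  classical
  have h0 := C.card_fracSupport_le h
  rcases C.exists_isCayley_or h habs (d + 1) with ⟨E, h1, h2, h3, h4⟩ | ⟨E, μ, -, h2, -, -, h5⟩
  · exact ⟨E, h1, h2, h3, by omega⟩
  · have h6 := C.card_neg_le h μ
    have h7 := Finset.card_le_card (Finset.filter_subset_filter
      (fun v => ∑ i, μ i * coord a B (a i) v < 0) h2)
    omega

end

end LatticeCone

namespace LatticeCone

set_option linter.unusedSectionVars false

section

variable {ι W : Type} [Fintype ι] [DecidableEq ι] [AddCommGroup W] [Module ℝ W]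
  {a : ι → W} {B : Finset ι} {M : AddSubgroup W} {ht : W →ₗ[ℝ] ℝ} {N d k : ℕ} {ε : ℝ} {x : W}

/-- `o i` is the element of `B \ E` to which the generator `a i` reduces modulo the span of `E`,
or `none` if `a i` lies in this span. -/
structure IsCayleyMap (a : ι → W) (B E : Finset ι) (o : ι → Option ι) : Prop where
  mem : ∀ i v, o i = some v → v ∈ B \ E
  coord_eq : ∀ i, ∀ u ∉ E, coord a B (a i) u = if o i = some u then 1 else 0

lemma IsCayley.exists_map {E : Finset ι} (h : IsCayley a B E) : ∃ o, IsCayleyMap a B E o := by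
  have : ∀ i, ∃ o : Option ι, (∀ v, o = some v → v ∈ B \ E) ∧
      ∀ u ∉ E, coord a B (a i) u = if o = some u then 1 else 0 := by
    intro i
    rcases h i with h | ⟨v, hv, h⟩
    · exact ⟨none, by simp, fun u hu => by simp [h u hu]⟩
    · refine ⟨some v, fun w hw => by rwa [← Option.some.inj hw], fun u hu => ?_⟩
      rw [h u hu]
      simp only [Option.some.injEq, eq_comm]
  choose o h1 h2 using this
  exact ⟨o, h1, h2⟩

/-- The remainder of a generator, a lattice vector in the span of `E`. -/
def remainder (a : ι → W) (o : ι → Option ι) (i : ι) : W := a i - (o i).elim 0 a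

lemma IsCayleyMap.coord_remainder {E : Finset ι} {o : ι → Option ι} (ho : IsCayleyMap a B E o)
    (h : IsBase a B) (i j : ι) :
    coord a B (remainder a o i) j = if j ∈ E then coord a B (a i) j else 0 := by
  rw [remainder, map_sub, Pi.sub_apply]
  cases hoi : o i with
  | none =>
    split_ifs with hj
    · simp
    · rw [ho.coord_eq i j hj, hoi]; simp
  | some v =>
    have hv := Finset.mem_sdiff.1 (ho.mem i v hoi)
    simp only [Option.elim_some]
    rw [h.coord_self hv.1]
    split_ifs with hj
    · rw [Pi.single_eq_of_ne (by rintro rfl; exact hv.2 hj), sub_zero]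
    · rw [ho.coord_eq i j hj, hoi, Pi.single_apply]
      by_cases hjv : j = v
      · simp [hjv]
      · simp [hjv, Ne.symm hjv]

/-- The rounded coordinates of the remainder of a generator. -/
def roundCode (a : ι → W) (B E : Finset ι) (m : ℕ) (i : ι) : E → Fin (2 * m + 1) := fun j =>
  ⟨(⌊m * coord a B (a i) j⌋ + m).toNat % (2 * m + 1), Nat.mod_lt _ (by omega)⟩

lemma SpreadConfig.remainder_eq (C : SpreadConfig a M ht N d k ε x) (hε1 : ε ≤ 1)
    (h : IsBase a B) (habs : ∀ i v, |coord a B (a i) v| ≤ 1) {E : Finset ι} {o : ι → Option ι}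
    (ho : IsCayleyMap a B E o) {D m : ℕ} (hE : E.card ≤ D)
    (hm : 2 * (k + 1) * (D + 1) ≤ ε * m) {i j : ι}
    (hij : roundCode a B E m i = roundCode a B E m j) : remainder a o i = remainder a o j := by
  have hmem : ∀ i, remainder a o i ∈ M := fun i => by
    refine AddSubgroup.sub_mem _ (C.mem i) ?_
    cases o i with
    | none => exact zero_mem _
    | some v => exact C.mem v
  refine C.eq_of_close hε1 h hE hm (hmem i) (hmem j) (fun l hl => ?_) fun l hl => ?_
  · rw [ho.coord_remainder h, ho.coord_remainder h, if_neg hl, if_neg hl]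
  · rw [ho.coord_remainder h, ho.coord_remainder h, if_pos hl, if_pos hl]
    refine Int.abs_sub_lt_one_of_floor_eq_floor ?_
    have hb : ∀ i, -(m : ℤ) ≤ ⌊m * coord a B (a i) l⌋ ∧ ⌊m * coord a B (a i) l⌋ ≤ m := by
      intro i
      obtain ⟨h1, h2⟩ := abs_le.1 (habs i l)
      have hm0 : (0 : ℝ) ≤ m := m.cast_nonneg
      refine ⟨Int.le_floor.2 ?_, ?_⟩
      · push_cast; nlinarith
      · have h3 := Int.floor_le (m * coord a B (a i) l)
        have : ((⌊m * coord a B (a i) l⌋ : ℤ) : ℝ) ≤ (m : ℤ) := by push_cast; nlinarith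
        exact_mod_cast this
    have h1 := congrArg Fin.val (congrFun hij ⟨l, hl⟩)
    simp only [roundCode] at h1
    have h2 := hb i
    have h3 := hb j
    rw [Nat.mod_eq_of_lt (by omega), Nat.mod_eq_of_lt (by omega)] at h1
    omega

lemma card_roundCode_le {E : Finset ι} {D m : ℕ} (hE : E.card ≤ D) :
    Fintype.card (E → Fin (2 * m + 1)) ≤ (2 * m + 1) ^ D := by
  rw [Fintype.card_fun, Fintype.card_fin, Fintype.card_coe]
  exact Nat.pow_le_pow_right (by omega) hE

lemma SpreadConfig.card_class_le (C : SpreadConfig a M ht N d k ε x) (hε1 : ε ≤ 1)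
    (h : IsBase a B) (habs : ∀ i v, |coord a B (a i) v| ≤ 1) {E : Finset ι} {o : ι → Option ι}
    (ho : IsCayleyMap a B E o) {D m : ℕ} (hE : E.card ≤ D)
    (hm : 2 * (k + 1) * (D + 1) ≤ ε * m) (w : Option ι) :
    (Finset.univ.filter fun i => o i = w).card ≤ (2 * m + 1) ^ D := by
  refine le_trans ?_ (card_roundCode_le hE)
  refine Finset.card_le_card_of_injOn (t := Finset.univ) (roundCode a B E m)
    (fun _ _ => Finset.mem_univ _) fun i hi j hj hij => C.inj ?_
  have h1 := C.remainder_eq hε1 h habs ho hE hm hij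
  rw [Finset.mem_coe, Finset.mem_filter] at hi hj
  rw [remainder, remainder, hi.2, hj.2] at h1
  exact sub_left_injective h1

/-- Only few elements of `B \ E` are the reduction of a second generator. -/
lemma SpreadConfig.card_nontrivial_le (C : SpreadConfig a M ht N d k ε x) (hε1 : ε ≤ 1)
    (h : IsBase a B) (habs : ∀ i v, |coord a B (a i) v| ≤ 1) {E : Finset ι} {o : ι → Option ι}
    (ho : IsCayleyMap a B E o) (hfE : fracSupport a M B ⊆ E) {D m : ℕ} (hE : E.card ≤ D)
    (hm : 2 * (k + 1) * (D + 1) ≤ ε * m) :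
    (Finset.univ.filter fun v => v ∈ B \ E ∧ ∃ i, i ≠ v ∧ o i = some v).card ≤
      ((2 * m + 1) ^ D * (2 * m + 1) ^ D) * ((2 * m + 1) ^ D * (k + 1)) := by
  classical
  set Q := (2 * m + 1) ^ D with hQ
  have hQ0 : 0 < Q := by positivity
  obtain ⟨p, hp, hpx⟩ := C.minPoint.inInt
  set R := Finset.univ.filter fun v => v ∈ B \ E ∧ ∃ i, i ≠ v ∧ o i = some v with hR
  have hself : ∀ v ∈ B \ E, o v = some v := by
    intro v hv
    obtain ⟨hvB, hvE⟩ := Finset.mem_sdiff.1 hv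
    have h1 := ho.coord_eq v v hvE
    rw [h.coord_self hvB, Pi.single_eq_same] at h1
    by_contra hne
    rw [if_neg hne] at h1
    exact one_ne_zero h1
  have hlarge : ∀ v, v ∈ R → ∃ j, o j = some v ∧ 1 / (Q : ℝ) ≤ p j := by
    intro v hv
    obtain ⟨hvBE, -⟩ := (Finset.mem_filter.1 hv).2
    obtain ⟨hvB, hvE⟩ := Finset.mem_sdiff.1 hvBE
    have h1 : coord a B x v = ∑ i ∈ Finset.univ.filter fun i => o i = some v, p i := by
      rw [← hpx, coord_sum, Finset.sum_filter]
      refine Finset.sum_congr rfl fun i _ => ?_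
      rw [ho.coord_eq i v hvE]
      split_ifs <;> simp
    have h2 : 0 < coord a B x v := by
      rw [h1]
      exact Finset.sum_pos (fun i _ => hp i) ⟨v, by simpa using hself v hvBE⟩
    have h3 : 1 ≤ coord a B x v := by
      obtain ⟨t, h'⟩ := exists_int_of_notMem_fracSupport h (fun hv' => hvE (hfE hv'))
        C.minPoint.mem
      rw [h'] at h2 ⊢
      have : 0 < t := by exact_mod_cast h2
      exact_mod_cast this
    by_contra! hcon
    have h4 : ∑ i ∈ Finset.univ.filter (fun i => o i = some v), p i <
        ∑ i ∈ Finset.univ.filter (fun i => o i = some v), 1 / (Q : ℝ) :=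
      Finset.sum_lt_sum_of_nonempty ⟨v, by simpa using hself v hvBE⟩ fun i hi =>
        hcon i (by simpa using hi)
    rw [Finset.sum_const, nsmul_eq_mul, mul_one_div, ← h1] at h4
    have h5 : ((Finset.univ.filter fun i => o i = some v).card : ℝ) ≤ Q := by
      exact_mod_cast C.card_class_le hε1 h habs ho hE hm (some v)
    have h6 : ((Finset.univ.filter fun i => o i = some v).card : ℝ) / Q ≤ 1 :=
      div_le_one_of_le₀ h5 (by positivity)
    linarith
  choose! q hq hqp using hlarge
  have hother : ∀ v, v ∈ R → ∃ j, o j = some v ∧ j ≠ q v := by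
    intro v hv
    obtain ⟨hvBE, i, hiv, hi⟩ := (Finset.mem_filter.1 hv).2
    by_cases hvq : v = q v
    · exact ⟨i, hi, by rwa [← hvq]⟩
    · exact ⟨v, hself v hvBE, hvq⟩
  choose! q' hq' hqq using hother
  by_contra! hcon
  let f : ι → (E → Fin (2 * m + 1)) × (E → Fin (2 * m + 1)) := fun v =>
    (roundCode a B E m (q' v), roundCode a B E m (q v))
  have hcard : (Finset.univ : Finset ((E → Fin (2 * m + 1)) × (E → Fin (2 * m + 1)))).card *
      (Q * (k + 1)) < R.card := by
    rw [Finset.card_univ, Fintype.card_prod]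
    exact lt_of_le_of_lt (Nat.mul_le_mul_right _ (Nat.mul_le_mul (card_roundCode_le hE)
      (card_roundCode_le hE))) hcon
  obtain ⟨w, -, hw⟩ := Finset.exists_lt_card_fiber_of_mul_lt_card_of_maps_to
    (f := f) (fun _ _ => Finset.mem_univ _) hcard
  set R' := R.filter fun v => f v = w with hR'
  have hR'R : ∀ v ∈ R', v ∈ R := fun v hv => (Finset.mem_filter.1 hv).1
  have hR'0 : 0 < R'.card := by omega
  obtain ⟨v₀, hv₀⟩ := Finset.card_pos.1 hR'0
  have hΔ : ∀ v ∈ R', a (q' v) - a (q v) = a (q' v₀) - a (q v₀) := by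
    have h1 : ∀ v ∈ R', a (q' v) - a (q v) = remainder a o (q' v) - remainder a o (q v) := by
      intro v hv
      rw [remainder, remainder, hq' v (hR'R v hv), hq v (hR'R v hv), sub_sub_sub_cancel_right]
    intro v hv
    have h2 : f v = f v₀ := (Finset.mem_filter.1 hv).2.trans (Finset.mem_filter.1 hv₀).2.symm
    rw [h1 v hv, h1 v₀ hv₀, C.remainder_eq hε1 h habs ho hE hm (congrArg Prod.fst h2),
      C.remainder_eq hε1 h habs ho hE hm (congrArg Prod.snd h2)]
  have hzero : a (q' v₀) - a (q v₀) = 0 := by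
    refine C.eq_zero_of_shift C.minPoint (AddSubgroup.sub_mem _ (C.mem _) (C.mem _))
      (by simp [C.ht_eq]) fun t htk => ?_
    set τ : ℝ := t / R'.card with hτ
    have hR'0' : (0 : ℝ) < R'.card := by exact_mod_cast hR'0
    have hτ0 : 0 ≤ τ := by positivity
    have hτQ : τ < 1 / Q := by
      have hQ0' : (0 : ℝ) < Q := by exact_mod_cast hQ0
      rw [hτ, div_lt_div_iff₀ hR'0' hQ0', one_mul]
      have : t * Q < R'.card := lt_of_le_of_lt (by nlinarith) hw
      exact_mod_cast this
    have hsum : x + (t : ℝ) • (a (q' v₀) - a (q v₀)) = ∑ i, (p i + ∑ v ∈ R', τ *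
        ((if i = q' v then 1 else 0) - if i = q v then 1 else 0)) • a i := by
      simp only [add_smul, Finset.sum_add_distrib, hpx, Finset.sum_smul]
      rw [Finset.sum_comm]
      simp only [mul_smul, sub_smul, ite_smul, one_smul, zero_smul, ← Finset.smul_sum,
        Finset.sum_sub_distrib, Finset.sum_ite_eq', Finset.mem_univ, if_true]
      rw [← Finset.sum_sub_distrib, Finset.sum_congr rfl hΔ, Finset.sum_const,
        ← Nat.cast_smul_eq_nsmul ℝ, smul_smul τ, hτ, div_mul_cancel₀ _ hR'0'.ne']
    rw [hsum]
    refine ⟨_, fun i => ?_, rfl⟩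
    have hge : ∑ v ∈ R', τ * (0 - if i = q v then 1 else 0) ≤ ∑ v ∈ R', τ *
        ((if i = q' v then 1 else 0) - if i = q v then 1 else 0) := by
      refine Finset.sum_le_sum fun v _ => mul_le_mul_of_nonneg_left ?_ hτ0
      gcongr
      split_ifs <;> norm_num
    by_cases hi : ∃ v ∈ R', i = q v
    · obtain ⟨v, hv, rfl⟩ := hi
      have h1 : ∑ u ∈ R', τ * (0 - if q v = q u then 1 else 0) = -τ := by
        rw [Finset.sum_eq_single v]
        · simp
        · intro u hu huv
          rw [if_neg fun h1 => huv ?_]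
          · simp
          · have h2 := hq u (hR'R u hu)
            rw [← h1, hq v (hR'R v hv)] at h2
            exact (Option.some.inj h2).symm
        · exact fun h1 => absurd hv h1
      have := hqp v (hR'R v hv)
      linarith
    · push Not at hi
      have h1 : ∑ u ∈ R', τ * (0 - if i = q u then 1 else 0) = 0 :=
        Finset.sum_eq_zero fun u hu => by rw [if_neg (hi u hu)]; simp
      have := hp i
      linarith
  exact hqq v₀ (hR'R v₀ hv₀) (C.inj (sub_eq_zero.1 hzero))

/-- There are few bases. -/
lemma SpreadConfig.card_bases_le (C : SpreadConfig a M ht N d k ε x) (hε1 : ε ≤ 1)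
    {D m : ℕ} (hD : 4 * d + (d + 1) * (2 * d + 1) ≤ D) (hm : 2 * (k + 1) * (D + 1) ≤ ε * m)
    (T : Finset (Finset ι)) (hT : ∀ B ∈ T, IsBase a B) :
    T.card ≤ 2 ^ ((2 * m + 1) ^ D + (2 * m + 1) ^ D *
      (((2 * m + 1) ^ D * (2 * m + 1) ^ D) * ((2 * m + 1) ^ D * (k + 1)))) := by
  classical
  obtain ⟨B, h, habs⟩ := C.exists_base_abs_le_one
  obtain ⟨E, hfE, hEB, hcay, hE⟩ := C.exists_isCayley h habs
  replace hE := hE.trans hD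
  obtain ⟨o, ho⟩ := hcay.exists_map
  set R := Finset.univ.filter fun v => v ∈ B \ E ∧ ∃ i, i ≠ v ∧ o i = some v with hR
  set X := (Finset.univ.filter fun i => o i = none) ∪
    R.biUnion fun v => Finset.univ.filter fun i => o i = some v with hX
  have hXcard : X.card ≤ (2 * m + 1) ^ D + (2 * m + 1) ^ D *
      (((2 * m + 1) ^ D * (2 * m + 1) ^ D) * ((2 * m + 1) ^ D * (k + 1))) := by
    refine (Finset.card_union_le _ _).trans (Nat.add_le_add
      (C.card_class_le hε1 h habs ho hE hm none) ?_)
    refine (Finset.card_biUnion_le_card_mul _ _ _ fun v _ =>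
      C.card_class_le hε1 h habs ho hE hm (some v)).trans ?_
    rw [mul_comm]
    exact Nat.mul_le_mul_left _ (C.card_nontrivial_le hε1 h habs ho hfE hE hm)
  have htriv : ∀ i ∉ X, ∀ B', IsBase a B' → i ∈ B' := by
    intro i hi B' hB'
    rw [hX, Finset.mem_union, not_or] at hi
    obtain ⟨hi1, hi2⟩ := hi
    cases hoi : o i with
    | none => exact absurd hoi (by simpa using hi1)
    | some v =>
      have hv := ho.mem i v hoi
      have hvR : v ∉ R := fun hvR => hi2 (Finset.mem_biUnion.2 ⟨v, hvR, by simpa using hoi⟩)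
      have honly : ∀ j, o j = some v → j = v := by
        intro j hj
        by_contra hne
        exact hvR (Finset.mem_filter.2 ⟨Finset.mem_univ _, hv, j, hne, hj⟩)
      obtain rfl := honly i hoi
      by_contra hiB'
      have h1 := coord_sum (a := a) (coord a B' (a i)) B i
      rw [hB'.isCoord.sum_apply, ho.coord_eq i i (Finset.mem_sdiff.1 hv).2, if_pos hoi] at h1
      have h2 : ∑ j, coord a B' (a i) j * coord a B (a j) i = 0 := by
        refine Finset.sum_eq_zero fun j _ => ?_
        by_cases hj : o j = some i
        · rw [honly j hj, hB'.isCoord.apply_of_notMem _ i hiB', zero_mul]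
        · rw [ho.coord_eq j i (Finset.mem_sdiff.1 hv).2, if_neg hj, mul_zero]
      rw [h2] at h1
      exact one_ne_zero h1
  have h1 : T.card ≤ X.powerset.card := by
    refine Finset.card_le_card_of_injOn (fun B' => B' ∩ X)
      (fun B' _ => Finset.mem_powerset.2 Finset.inter_subset_right) ?_
    intro B₁ h₁ B₂ h₂ h12
    ext i
    by_cases hi : i ∈ X
    · have := Finset.ext_iff.1 h12 i
      simpa [hi] using this
    · exact iff_of_true (htriv i hi B₁ (hT B₁ h₁)) (htriv i hi B₂ (hT B₂ h₂))
  rw [Finset.card_powerset] at h1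
  exact h1.trans (Nat.pow_le_pow_right (by norm_num) hXcard)

end

/-- The total number of lattice points in the boxes of a family of bases is bounded in terms of
`d` and `k` only. -/
theorem exists_bound_sum_card_box (d k : ℕ) : ∃ b : ℕ,
    ∀ {ι W : Type} [Fintype ι] [DecidableEq ι] [AddCommGroup W] [Module ℝ W] {a : ι → W}
      {M : AddSubgroup W} {ht : W →ₗ[ℝ] ℝ} {N : ℕ} {x : W}, BoundedConfig a M ht N d k →
      Function.Injective a → IsMinPoint a M ht N d x →
      ∀ (T : Finset (Finset ι)), (∀ B ∈ T, IsBase a B) → ∀ (s : W) (S : Finset ι → Finset W),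
      (∀ B ∈ T, ∀ p ∈ S B, p ∈ M ∧
        ∀ j ∈ B, 0 < coord a B (p + s) j ∧ coord a B (p + s) j < 1) →
      ∑ B ∈ T, (S B).card ≤ b := by
  obtain ⟨ε, hε, hε1, H⟩ := exists_coeff_lower_bound d k
  set D := 4 * d + (d + 1) * (2 * d + 1) with hD
  obtain ⟨m, hm⟩ := exists_nat_ge (2 * (k + 1) * (D + 1) / ε)
  rw [div_le_iff₀' hε] at hm
  refine ⟨2 ^ ((2 * m + 1) ^ D + (2 * m + 1) ^ D *
      (((2 * m + 1) ^ D * (2 * m + 1) ^ D) * ((2 * m + 1) ^ D * (k + 1)))) * m ^ (4 * d), ?_⟩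
  intro ι W _ _ _ _ a M ht N x C hinj hx T hT s S hS
  have C' : SpreadConfig a M ht N d k ε x :=
    { C with inj := hinj, minPoint := hx, coeff := H C hx }
  have hm' : 2 * (k + 1) * ((4 * d : ℕ) + 1) ≤ ε * m := by
    refine le_trans ?_ hm
    have : ((4 * d : ℕ) : ℝ) ≤ D := by exact_mod_cast Nat.le_add_right _ _
    gcongr
  calc ∑ B ∈ T, (S B).card ≤ T.card * m ^ (4 * d) := by
        rw [← smul_eq_mul]
        exact Finset.sum_le_card_nsmul _ _ _ fun B hB => C'.card_box_le hε1 (hT B hB) hm' s (S B)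
          (fun p hp => (hS B hB p hp).1) fun p hp => (hS B hB p hp).2
    _ ≤ _ := Nat.mul_le_mul_right _ (C'.card_bases_le hε1 le_rfl hm T hT)

end LatticeCone

namespace LatticeCone

set_option linter.unusedSectionVars false

variable {ι W : Type*} [Fintype ι] [DecidableEq ι] [AddCommGroup W] [Module ℝ W]
  {a : ι → W} {B : Finset ι} {M : AddSubgroup W} {ht : W →ₗ[ℝ] ℝ} {N d k : ℕ}

/-- The group `M` is discrete: there are finitely many elements with bounded coordinates. -/
structure LatticeConfig (a : ι → W) (M : AddSubgroup W) (ht : W →ₗ[ℝ] ℝ) (N : ℕ) : Prop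
    extends Config a M ht where
  card_base : ∀ B, IsBase a B → B.card = N
  finite_box : ∀ B, IsBase a B → {p | p ∈ M ∧ ∀ j, |coord a B p j| ≤ 2}.Finite

/-- A vector whose coordinates are nonzero but smaller than those of all lattice points. -/
structure IsGenericShift (a : ι → W) (M : AddSubgroup W) (s : W) : Prop where
  ne_zero : ∀ B, IsBase a B → ∀ j ∈ B, coord a B s j ≠ 0
  lt_abs : ∀ B, IsBase a B → ∀ j ∈ B, ∀ p ∈ M, coord a B p j ≠ 0 →
    |coord a B s j| < |coord a B p j|

lemma exists_pos_le_of_finite {S : Set ℝ} (hS : S.Finite) :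
    ∃ η : ℝ, 0 < η ∧ ∀ r ∈ S, 0 < r → η ≤ r := by
  classical
  obtain ⟨δ, hδ, h⟩ := exists_small (hS.toFinset.filter fun r => 0 < r) id 1
    (fun i hi => (Finset.mem_filter.1 hi).2)
  refine ⟨δ, hδ, fun r hr hr0 => ?_⟩
  have := h r (by simp [hr, hr0])
  simp only [id, Pi.one_apply, mul_one] at this
  linarith

lemma LatticeConfig.exists_gap (C : LatticeConfig a M ht N) :
    ∃ η : ℝ, 0 < η ∧ ∀ B, IsBase a B → ∀ j, ∀ p ∈ M, coord a B p j ≠ 0 →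
      η ≤ |coord a B p j| := by
  classical
  have hfin : (⋃ B, ⋃ (_ : IsBase a B), ⋃ j, (fun p => |coord a B p j|) ''
      {p | p ∈ M ∧ ∀ j, |coord a B p j| ≤ 2}).Finite :=
    Set.finite_iUnion fun B => Set.finite_iUnion fun hB => Set.finite_iUnion fun j =>
      (C.finite_box B hB).image _
  obtain ⟨η, hη, h⟩ := exists_pos_le_of_finite hfin
  refine ⟨min η 1, lt_min hη one_pos, fun B hB j p hp hne => ?_⟩
  rcases le_or_gt 1 |coord a B p j| with h1 | h1
  · exact (min_le_right _ _).trans h1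
  refine (min_le_left _ _).trans ?_
  set e : ι → ℤ := fun l => if l = j then 0 else ⌊coord a B p l⌋ with he
  have hco : coord a B (p - ∑ l, (e l : ℝ) • a l) = coord a B p - fun l => (e l : ℝ) := by
    rw [map_sub, hB.isCoord.apply_sum]
    intro l hl
    simp [he, hB.isCoord.apply_of_notMem _ l hl]
  have hj : coord a B (p - ∑ l, (e l : ℝ) • a l) j = coord a B p j := by
    rw [hco]; simp [he]
  refine h _ ?_ (abs_pos.2 hne)
  refine Set.mem_iUnion.2 ⟨B, Set.mem_iUnion.2 ⟨hB, Set.mem_iUnion.2 ⟨j, _, ⟨AddSubgroup.sub_mem _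
    hp (C.sum_mem e), fun l => ?_⟩, by rw [← hj]⟩⟩⟩
  by_cases hl : l = j
  · rw [hl, hj]; linarith
  · rw [hco]
    simp only [Pi.sub_apply, he, if_neg hl, Int.self_sub_floor, Int.abs_fract]
    linarith [Int.fract_lt_one (coord a B p l)]

lemma LatticeConfig.exists_isGenericShift (C : LatticeConfig a M ht N) :
    ∃ s, InInt a s ∧ IsGenericShift a M s := by
  classical
  obtain ⟨η, hη, hgap⟩ := C.exists_gap
  obtain ⟨s₁, -, hs₁⟩ := Module.Dual.exists_forall_mem_ne_zero_of_forall_exists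
    (⊤ : Submodule ℝ W)
    (fun l : {q : Finset ι × ι // IsBase a q.1 ∧ q.2 ∈ q.1} =>
      (LinearMap.proj l.1.2 ∘ₗ coord a l.1.1 : Module.Dual ℝ W))
    (fun l => ⟨a l.1.2, trivial, by simp [l.2.1.coord_self l.2.2]⟩)
  obtain ⟨B₀, hB₀⟩ := C.exists_isBase
  set e := coord a B₀ s₁ with he
  obtain ⟨δ, hδ, hδ'⟩ := exists_small
    (Finset.univ.filter fun l : ι ⊕ (Finset ι × ι) =>
      0 < Sum.elim (fun _ => (1 : ℝ)) (fun q => |coord a q.1 (∑ i, a i) q.2|) l)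
    (Sum.elim (fun _ => (1 : ℝ)) (fun q => |coord a q.1 (∑ i, a i) q.2|))
    (Sum.elim (fun i => - e i) (fun q => |coord a q.1 s₁ q.2|))
    (fun i hi => (Finset.mem_filter.1 hi).2)
  set s₀ := ∑ i, a i + δ • s₁ with hs₀
  have hint : InInt a s₀ := by
    refine ⟨fun i => 1 + δ * e i, fun i => ?_, ?_⟩
    · have := hδ' (Sum.inl i) (by simp)
      simp only [Sum.elim_inl] at this
      linarith
    · simp only [add_smul, one_smul, Finset.sum_add_distrib, mul_smul, ← Finset.smul_sum]
      rw [he, hB₀.isCoord.sum_apply]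
  have hne : ∀ B, IsBase a B → ∀ j ∈ B, coord a B s₀ j ≠ 0 := by
    intro B hB j hj
    have h1 : coord a B s₁ j ≠ 0 := hs₁ ⟨(B, j), hB, hj⟩
    rw [hs₀, map_add, map_smul, Pi.add_apply, Pi.smul_apply, smul_eq_mul]
    by_cases h0 : coord a B (∑ i, a i) j = 0
    · rw [h0, zero_add]; exact mul_ne_zero hδ.ne' h1
    · have h2 := hδ' (Sum.inr (B, j)) (by simpa using h0)
      simp only [Sum.elim_inr] at h2
      intro h3
      have h4 : |coord a B (∑ i, a i) j| = δ * |coord a B s₁ j| := by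
        rw [eq_neg_of_add_eq_zero_left h3, abs_neg, abs_mul, abs_of_pos hδ]
      linarith
  obtain ⟨t, ht0, htη⟩ := exists_small (Finset.univ : Finset (Finset ι × ι)) (fun _ => η)
    (fun q => |coord a q.1 s₀ q.2|) (fun _ _ => hη)
  refine ⟨t • s₀, hint.smul ht0, ⟨fun B hB j hj => ?_, fun B hB j hj p hp hpne => ?_⟩⟩
  · rw [map_smul, Pi.smul_apply, smul_eq_mul]
    exact mul_ne_zero ht0.ne' (hne B hB j hj)
  · refine lt_of_lt_of_le ?_ (hgap B hB j p hp hpne)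
    rw [map_smul, Pi.smul_apply, smul_eq_mul, abs_mul, abs_of_pos ht0]
    linarith [htη (B, j) (Finset.mem_univ _)]

lemma IsGenericShift.neg {s : W} (h : IsGenericShift a M s) : IsGenericShift a M (-s) :=
  ⟨fun B hB j hj => by simpa using h.ne_zero B hB j hj, fun B hB j hj p hp hne => by
    simpa using h.lt_abs B hB j hj p hp hne⟩

section

variable {s p : W}

lemma IsGenericShift.coord_add_ne_zero (h : IsGenericShift a M s) (hB : IsBase a B) {j : ι}
    (hj : j ∈ B) (hp : p ∈ M) : coord a B (p + s) j ≠ 0 := by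
  rw [map_add, Pi.add_apply]
  intro h0
  by_cases hp0 : coord a B p j = 0
  · rw [hp0, zero_add] at h0; exact h.ne_zero B hB j hj h0
  · have := h.lt_abs B hB j hj p hp hp0
    rw [eq_neg_of_add_eq_zero_left h0, abs_neg] at this
    exact lt_irrefl _ this

lemma IsGenericShift.coord_nonneg (h : IsGenericShift a M s) (hB : IsBase a B) {j : ι}
    (hj : j ∈ B) (hp : p ∈ M) (hpos : 0 < coord a B (p + s) j) : 0 ≤ coord a B p j := by
  rw [map_add, Pi.add_apply] at hpos
  by_contra! hneg
  have := h.lt_abs B hB j hj p hp hneg.ne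
  rw [abs_of_neg hneg] at this
  linarith [le_abs_self (coord a B s j)]

lemma IsGenericShift.coord_add_pos (h : IsGenericShift a M s) (hB : IsBase a B) {j : ι}
    (hj : j ∈ B) (hp : p ∈ M) (hpos : 0 < coord a B p j) : 0 < coord a B (p + s) j := by
  rw [map_add, Pi.add_apply]
  have := h.lt_abs B hB j hj p hp hpos.ne'
  rw [abs_of_pos hpos] at this
  linarith [neg_abs_le (coord a B s j)]

lemma IsGenericShift.coord_le_one (h : IsGenericShift a M s) (hB : IsBase a B) {j : ι}
    (hj : j ∈ B) (hp : p ∈ M) (hpos : coord a B (p + s) j < 1) (haj : a j ∈ M) :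
    coord a B p j ≤ 1 := by
  have h1 : coord a B (a j - p) j = 1 - coord a B p j := by
    rw [map_sub, hB.coord_self hj, Pi.sub_apply, Pi.single_eq_same]
  have h2 := h.neg.coord_nonneg hB hj (AddSubgroup.sub_mem _ haj hp) (by
    rw [← sub_eq_add_neg, map_sub, Pi.sub_apply, h1]
    rw [map_add, Pi.add_apply] at hpos
    linarith)
  linarith

lemma LatticeConfig.inCone_iff (C : LatticeConfig a M ht N) (hs : InInt a s)
    (h : IsGenericShift a M s) (hp : p ∈ M) : InCone a p ↔ InCone a (p + s) := by
  refine ⟨fun hc => hc.add hs.inCone, fun hc => ?_⟩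
  obtain ⟨B, hB, h0⟩ := C.exists_base_of_inCone hc
  refine ⟨coord a B p, fun j => ?_, hB.isCoord.sum_apply p⟩
  by_cases hj : j ∈ B
  · exact h.coord_nonneg hB hj hp ((h0 j).lt_of_ne' (h.coord_add_ne_zero hB hj hp))
  · rw [hB.isCoord.apply_of_notMem p j hj]

lemma LatticeConfig.inInt_iff (C : LatticeConfig a M ht N) (hs : InInt a s)
    (h : IsGenericShift a M s) (hp : p ∈ M) : InInt a p ↔ InCone a (p + -s) := by
  refine ⟨fun hc => ?_, fun hc => ?_⟩
  · obtain ⟨c, hc, rfl⟩ := hc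
    obtain ⟨e, he, hes⟩ := hs
    obtain ⟨δ, hδ, hδ'⟩ := exists_small Finset.univ c e (fun i _ => hc i)
    have hcone : InCone a (∑ i, c i • a i - min δ 1 • s) := by
      refine ⟨fun i => c i - min δ 1 * e i, fun i => ?_, ?_⟩
      · have h1 := hδ' i (Finset.mem_univ _)
        have h2 := mul_le_mul_of_nonneg_right (min_le_left δ 1) (he i).le
        linarith
      · simp only [sub_smul, mul_smul, Finset.sum_sub_distrib, ← Finset.smul_sum, hes]
    set p := ∑ i, c i • a i
    obtain ⟨B, hB, h0⟩ := C.exists_base_of_inCone hcone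
    refine ⟨coord a B (p + -s), fun j => ?_, hB.isCoord.sum_apply _⟩
    by_cases hj : j ∈ B
    · have h1 := h0 j
      rw [map_sub, map_smul, Pi.sub_apply, Pi.smul_apply, smul_eq_mul] at h1
      have hm : 0 < min δ 1 := lt_min hδ one_pos
      rcases lt_trichotomy (coord a B p j) 0 with h2 | h2 | h2
      · have h3 := h.lt_abs B hB j hj p hp h2.ne
        rw [abs_of_neg h2] at h3
        have h4 := neg_abs_le (coord a B s j)
        have h5 := abs_nonneg (coord a B s j)
        nlinarith [min_le_right δ 1]
      · rw [← sub_eq_add_neg, map_sub, Pi.sub_apply, h2]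
        rw [h2] at h1
        nlinarith
      · exact (h.neg.coord_add_pos hB hj hp h2).le
    · rw [hB.isCoord.apply_of_notMem _ j hj]
  · have := hs.add hc
    rwa [add_neg_cancel_comm_assoc] at this

end

/-- The bases which are lower facets for the lifting heights `ω`. -/
def IsLower (a : ι → W) (ω : ι → ℝ) (B : Finset ι) : Prop :=
  IsBase a B ∧ ∀ w ∉ B, ∑ v, coord a B (a w) v * ω v < ω w

lemma exists_generic_height (a : ι → W) : ∃ ω : ι → ℝ, ∀ B, IsBase a B → ∀ w ∉ B,
    ω w ≠ ∑ v, coord a B (a w) v * ω v := by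
  classical
  obtain ⟨ω, -, hω⟩ := Module.Dual.exists_forall_mem_ne_zero_of_forall_exists
    (⊤ : Submodule ℝ (ι → ℝ))
    (fun l : {q : Finset ι × ι // IsBase a q.1 ∧ q.2 ∉ q.1} =>
      (LinearMap.proj l.1.2 - ∑ v, coord a l.1.1 (a l.1.2) v • LinearMap.proj v :
        Module.Dual ℝ (ι → ℝ)))
    (fun l => ⟨Pi.single l.1.2 1, trivial, by
      simp [Pi.single_apply, l.2.1.isCoord.apply_of_notMem _ _ l.2.2]⟩)
  refine ⟨ω, fun B hB w hw h => hω ⟨(B, w), hB, hw⟩ ?_⟩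
  simp [h]

/-- The cost of a representation is at least the cost of the representation with respect to a
lower facet. -/
lemma IsLower.cost_le {ω : ι → ℝ} (h : IsLower a ω B) {c : ι → ℝ} (hc : ∀ i, 0 ≤ c i) :
    ∑ v, coord a B (∑ i, c i • a i) v * ω v ≤ ∑ i, c i * ω i ∧
      ((∑ v, coord a B (∑ i, c i • a i) v * ω v = ∑ i, c i * ω i) → ∀ i ∉ B, c i = 0) := by
  have h1 : ∑ v, coord a B (∑ i, c i • a i) v * ω v =
      ∑ i, c i * ∑ v, coord a B (a i) v * ω v := by
    simp only [coord_sum, Finset.sum_mul, Finset.mul_sum, mul_assoc]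
    exact Finset.sum_comm
  have h2 : ∀ i ∈ Finset.univ, c i * ∑ v, coord a B (a i) v * ω v ≤ c i * ω i := by
    intro i _
    refine mul_le_mul_of_nonneg_left ?_ (hc i)
    by_cases hi : i ∈ B
    · rw [h.1.coord_self hi]; simp [Pi.single_apply]
    · exact (h.2 i hi).le
  rw [h1]
  refine ⟨Finset.sum_le_sum h2, fun heq i hi => ?_⟩
  have h3 := (Finset.sum_eq_sum_iff_of_le h2).1 heq i (Finset.mem_univ _)
  by_contra hne
  exact (h.2 i hi).ne (mul_left_cancel₀ hne h3)

lemma IsLower.eq_of_coord_pos {ω : ι → ℝ} {B' : Finset ι} (h : IsLower a ω B)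
    (h' : IsLower a ω B') {y : W} (hy : ∀ j ∈ B, 0 < coord a B y j)
    (hy' : ∀ j ∈ B', 0 < coord a B' y j) : B = B' := by
  have hn : ∀ B, IsBase a B → (∀ j ∈ B, 0 < coord a B y j) → ∀ j, 0 ≤ coord a B y j := by
    intro B hB hy j
    by_cases hj : j ∈ B
    · exact (hy j hj).le
    · rw [hB.isCoord.apply_of_notMem y j hj]
  obtain ⟨h1, h2⟩ := h.cost_le (hn B' h'.1 hy')
  obtain ⟨h3, h4⟩ := h'.cost_le (hn B h.1 hy)
  rw [h'.1.isCoord.sum_apply] at h1 h2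
  rw [h.1.isCoord.sum_apply] at h3 h4
  refine Finset.Subset.antisymm (fun j hj => ?_) fun j hj => ?_
  · by_contra hjn
    exact (hy j hj).ne' (h4 (le_antisymm h3 h1) j hjn)
  · by_contra hjn
    exact (hy' j hj).ne' (h2 (le_antisymm h1 h3) j hjn)

lemma Config.exists_isLower (C : Config a M ht) {ω : ι → ℝ}
    (hω : ∀ B, IsBase a B → ∀ w ∉ B, ω w ≠ ∑ v, coord a B (a w) v * ω v) {y : W}
    (hy : InCone a y) (hne : ∀ B, IsBase a B → ∀ j ∈ B, coord a B y j ≠ 0) :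
    ∃ B, IsLower a ω B ∧ ∀ j ∈ B, 0 < coord a B y j := by
  classical
  obtain ⟨B₀, hB₀⟩ := C.exists_base_of_inCone hy
  obtain ⟨B, hB, hmin⟩ := Finset.exists_min_image
    (Finset.univ.filter fun B => IsBase a B ∧ ∀ l, 0 ≤ coord a B y l)
    (fun B => ∑ v, coord a B y v * ω v) ⟨B₀, by simpa using hB₀⟩
  obtain ⟨hB, h0⟩ := (Finset.mem_filter.1 hB).2
  have hpos : ∀ j ∈ B, 0 < coord a B y j := fun j hj => (h0 j).lt_of_ne' (hne B hB j hj)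
  refine ⟨B, ⟨hB, fun w hw => ?_⟩, hpos⟩
  by_contra! hle
  have hlt := hle.lt_of_ne (hω B hB w hw)
  obtain ⟨j, hj, hγ, hr⟩ := C.ratio_test hB w h0
  obtain ⟨hB', hco⟩ := hB.exchange hw hj hγ.ne'
  have hw0 : coord a B (a w) w = 0 := hB.isCoord.apply_of_notMem _ w hw
  set θ := coord a B y j / coord a B (a w) j with hθ
  have hθ0 : 0 < θ := div_pos (hpos j hj) hγ
  have h1 := hmin (insert w (B.erase j)) (Finset.mem_filter.2 ⟨Finset.mem_univ _, hB', fun l => by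
    rw [hco y]
    simp only [Pi.add_apply, Pi.smul_apply, Pi.sub_apply, smul_eq_mul]
    by_cases hl : l = w
    · subst hl
      rw [Pi.single_eq_same, hw0, sub_zero, mul_one]
      linarith [h0 l]
    · rw [Pi.single_eq_of_ne hl]
      linarith [hr l]⟩)
  rw [hco y] at h1
  simp only [Pi.add_apply, Pi.smul_apply, Pi.sub_apply, smul_eq_mul, add_mul,
    Finset.sum_add_distrib, mul_assoc, ← Finset.mul_sum, sub_mul, Finset.sum_sub_distrib,
    Pi.single_apply, ite_mul, one_mul, zero_mul, Finset.sum_ite_eq', Finset.mem_univ, if_true] at h1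
  nlinarith

end LatticeCone

namespace LatticeCone

set_option linter.unusedSectionVars false

variable {ι W : Type*} [Fintype ι] [DecidableEq ι] [AddCommGroup W] [Module ℝ W]
  {a : ι → W} {B : Finset ι} {M : AddSubgroup W} {ht : W →ₗ[ℝ] ℝ} {N d k : ℕ} {s p q : W}

/-- The lattice points of the half-open box of `B` shifted by `-s`. -/
def boxSet (a : ι → W) (M : AddSubgroup W) (s : W) (B : Finset ι) : Set W :=
  {q | q ∈ M ∧ ∀ j ∈ B, 0 < coord a B (q + s) j ∧ coord a B (q + s) j < 1}

lemma LatticeConfig.finite_boxSet (C : LatticeConfig a M ht N) (h : IsGenericShift a M s)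
    (hB : IsBase a B) : (boxSet a M s B).Finite := by
  refine (C.finite_box B hB).subset fun q hq => ⟨hq.1, fun j => ?_⟩
  by_cases hj : j ∈ B
  · have h1 := h.coord_nonneg hB hj hq.1 (hq.2 j hj).1
    have h2 := h.coord_le_one hB hj hq.1 (hq.2 j hj).2 (C.mem j)
    rw [abs_of_nonneg h1]
    linarith
  · simp [hB.isCoord.apply_of_notMem q j hj]

lemma LatticeConfig.ht_of_mem_boxSet {n : ℕ} (C : LatticeConfig a M ht (n + 1)) (hs : InInt a s)
    (h : IsGenericShift a M s) (hB : IsBase a B) (hq : q ∈ boxSet a M s B) :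
    ht q = (⌊ht q⌋₊ : ℝ) ∧ ⌊ht q⌋₊ ≤ n := by
  have hne : B.Nonempty := by
    rw [← Finset.card_pos, C.card_base B hB]; exact Nat.succ_pos _
  have h0 : 0 ≤ ht q := by
    rw [← C.sum_coord hB]
    exact Finset.sum_nonneg fun j hj => h.coord_nonneg hB hj hq.1 (hq.2 j hj).1
  have hs0 : 0 < ht s := by
    obtain ⟨c, hc, rfl⟩ := hs
    rw [C.ht_sum]
    exact Finset.sum_pos (fun i _ => hc i) ⟨hne.choose, Finset.mem_univ _⟩
  have h1 : ht q < n + 1 := by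
    have h2 : ∑ j ∈ B, coord a B (q + s) j < ∑ _j ∈ B, (1 : ℝ) :=
      Finset.sum_lt_sum_of_nonempty hne fun j hj => (hq.2 j hj).2
    rw [C.sum_coord hB, map_add, Finset.sum_const, C.card_base B hB, nsmul_eq_mul, mul_one] at h2
    push_cast at h2
    linarith
  obtain ⟨t, hz⟩ := C.ht_int q hq.1
  rw [hz] at h0 h1 ⊢
  lift t to ℕ using by exact_mod_cast h0
  simp only [Int.cast_natCast, Nat.floor_natCast, true_and]
  have : t < n + 1 := by exact_mod_cast h1
  omega

/-- A lattice point whose shift is positive on `B` differs from a box point by a nonnegative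
integral combination of the basis. -/
lemma LatticeConfig.exists_boxSet_add (C : LatticeConfig a M ht N) (h : IsGenericShift a M s)
    (hB : IsBase a B) (hp : p ∈ M) (hpos : ∀ j ∈ B, 0 < coord a B (p + s) j) :
    ∃ q ∈ boxSet a M s B, ∃ e : ι →₀ ℕ, e.support ⊆ B ∧ p = q + ∑ j, (e j : ℝ) • a j := by
  set e : ι →₀ ℕ := Finsupp.equivFunOnFinite.symm fun j => ⌊coord a B (p + s) j⌋₊ with he
  have he' : ∀ j, e j = ⌊coord a B (p + s) j⌋₊ := fun j => rfl
  have hsup : e.support ⊆ B := by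
    intro j hj
    by_contra hjB
    rw [Finsupp.mem_support_iff, he', hB.isCoord.apply_of_notMem _ j hjB] at hj
    simp at hj
  have hmem : p - ∑ j, (e j : ℝ) • a j ∈ M :=
    AddSubgroup.sub_mem _ hp (by simpa using C.sum_mem fun j => (e j : ℤ))
  refine ⟨p - ∑ j, (e j : ℝ) • a j, ⟨hmem, fun j hj => ?_⟩, e, hsup, by abel⟩
  have hco : coord a B (p - ∑ j, (e j : ℝ) • a j + s) j =
      coord a B (p + s) j - ⌊coord a B (p + s) j⌋₊ := by
    rw [sub_add_eq_add_sub, map_sub, hB.isCoord.apply_sum]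
    · rfl
    · intro l hl
      simpa using fun hl' => hl (hsup (Finsupp.mem_support_iff.2 hl'))
  have h1 := h.coord_add_ne_zero hB hj hmem
  have h2 := Nat.floor_le (hpos j hj).le
  have h3 := Nat.lt_floor_add_one (coord a B (p + s) j)
  rw [hco] at h1 ⊢
  exact ⟨lt_of_le_of_ne (by linarith) h1.symm, by linarith⟩

lemma coord_add_sum_boxSet (hB : IsBase a B) {e : ι →₀ ℕ} (he : e.support ⊆ B) (q s : W) (j : ι) :
    coord a B (q + ∑ j, (e j : ℝ) • a j + s) j = coord a B (q + s) j + e j := by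
  rw [add_right_comm, map_add, hB.isCoord.apply_sum]
  · rfl
  · intro l hl
    simpa using fun hl' => hl (he (Finsupp.mem_support_iff.2 hl'))

lemma floor_coord_add (hB : IsBase a B) {e : ι →₀ ℕ} (he : e.support ⊆ B)
    (hq : q ∈ boxSet a M s B) :
    ∀ j, ⌊coord a B (q + ∑ j, (e j : ℝ) • a j + s) j⌋₊ = e j := by
  intro j
  rw [coord_add_sum_boxSet hB he]
  by_cases hj : j ∈ B
  · obtain ⟨h1, h2⟩ := hq.2 j hj
    rw [Nat.floor_add_natCast h1.le, Nat.floor_eq_zero.2 h2, zero_add]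
  · rw [hB.isCoord.apply_of_notMem _ j hj, zero_add, Nat.floor_natCast]

/-- Reflection in the center of the box exchanges the lattice points of the boxes shifted by `s`
and by `-s`. -/
lemma reflect_mem_boxSet (C : LatticeConfig a M ht N) (hB : IsBase a B)
    (hq : q ∈ boxSet a M (-s) B) : ∑ j ∈ B, a j - q ∈ boxSet a M s B := by
  refine ⟨AddSubgroup.sub_mem _ (AddSubgroup.sum_mem _ fun j _ => C.mem j) hq.1, fun j hj => ?_⟩
  have h1 : coord a B (∑ j ∈ B, a j - q + s) j = 1 - coord a B (q + -s) j := by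
    have h2 : ∑ j ∈ B, a j - q + s = ∑ j ∈ B, a j - (q + -s) := by abel
    have h3 : coord a B (∑ j ∈ B, a j) j = 1 := by
      rw [map_sum, Finset.sum_apply, Finset.sum_eq_single j]
      · rw [hB.coord_self hj, Pi.single_eq_same]
      · intro l hl hlj
        rw [hB.coord_self hl, Pi.single_eq_of_ne hlj.symm]
      · exact fun h => absurd hj h
    rw [h2, map_sub, Pi.sub_apply, h3]
  have := hq.2 j hj
  rw [h1]
  constructor <;> linarith

/-- Coefficients in the binomial basis are determined by the values. -/
lemma eq_of_sum_mul_choose_eq {n : ℕ} {f g : ℕ → ℤ}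
    (h : ∀ m : ℕ, ∑ i ∈ Finset.range (n + 1), f i * ((n + m - i).choose n : ℤ) =
      ∑ i ∈ Finset.range (n + 1), g i * ((n + m - i).choose n : ℤ)) :
    ∀ i ≤ n, f i = g i := by
  intro i
  induction i using Nat.strong_induction_on with
  | _ i ih =>
    intro hi
    have h1 : ∑ l ∈ Finset.range (n + 1), (f l - g l) * ((n + i - l).choose n : ℤ) = 0 := by
      simp only [sub_mul, Finset.sum_sub_distrib, h i, sub_self]
    rw [Finset.sum_eq_single i] at h1
    · simp only [Nat.add_sub_cancel, Nat.choose_self, Nat.cast_one, mul_one] at h1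
      linarith
    · intro l hl hli
      rw [Finset.mem_range] at hl
      rcases lt_or_gt_of_ne hli with hlt | hlt
      · rw [ih l hlt (by omega), sub_self, zero_mul]
      · rw [Nat.choose_eq_zero_of_lt (by omega), Nat.cast_zero, mul_zero]
    · intro hn
      exact absurd (Finset.mem_range.2 (by omega)) hn

/-- A half-open decomposition of the cone into the cones over the lower facets. -/
structure BoxDecomposition (a : ι → W) (M : AddSubgroup W) (ht : W →ₗ[ℝ] ℝ) (N : ℕ) (s : W)
    (ω : ι → ℝ) (T : Finset (Finset ι)) (S : Finset ι → Finset W) : Prop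
    extends LatticeConfig a M ht N where
  shift_inInt : InInt a s
  shift : IsGenericShift a M s
  generic : ∀ B, IsBase a B → ∀ w ∉ B, ω w ≠ ∑ v, coord a B (a w) v * ω v
  mem_lower : ∀ B, B ∈ T ↔ IsLower a ω B
  mem_box : ∀ B ∈ T, ∀ q, q ∈ S B ↔ q ∈ boxSet a M s B

lemma LatticeConfig.exists_boxDecomposition (C : LatticeConfig a M ht N) :
    ∃ s ω T S, BoxDecomposition a M ht N s ω T S := by
  classical
  obtain ⟨s, hs, h⟩ := C.exists_isGenericShift
  obtain ⟨ω, hω⟩ := exists_generic_height a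
  refine ⟨s, ω, Finset.univ.filter (IsLower a ω), fun B => if hB : IsBase a B then
    (C.finite_boxSet h hB).toFinset else ∅, { C with
      shift_inInt := hs, shift := h, generic := hω, mem_lower := by simp, mem_box := ?_ }⟩
  intro B hB q
  rw [dif_pos ((Finset.mem_filter.1 hB).2.1)]
  simp

variable {n : ℕ} {ω : ι → ℝ} {T : Finset (Finset ι)} {S : Finset ι → Finset W}

lemma BoxDecomposition.isBase (D : BoxDecomposition a M ht N s ω T S) (hB : B ∈ T) :
    IsBase a B := ((D.mem_lower B).1 hB).1

/-- The lattice points of height `m` in the cone, counted by the boxes containing them. -/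
lemma BoxDecomposition.ncard_height (D : BoxDecomposition a M ht (n + 1) s ω T S) (m : ℕ) :
    {p | p ∈ M ∧ ht p = m ∧ InCone a p}.ncard =
      ∑ x ∈ T.sigma S, (n + m - ⌊ht x.2⌋₊).choose n := by
  classical
  set F := ((T.sigma S).filter fun x => ⌊ht x.2⌋₊ ≤ m).sigma
    fun x => x.1.finsuppAntidiag (m - ⌊ht x.2⌋₊) with hF
  have hmem : ∀ x, x ∈ F ↔ (x.1.1 ∈ T ∧ x.1.2 ∈ S x.1.1) ∧ ⌊ht x.1.2⌋₊ ≤ m ∧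
      x.1.1.sum x.2 = m - ⌊ht x.1.2⌋₊ ∧ x.2.support ⊆ x.1.1 := by
    intro x
    rw [hF, Finset.mem_sigma, Finset.mem_filter, Finset.mem_sigma, Finset.mem_finsuppAntidiag,
      and_assoc]
  set φ : (Σ _ : (Σ _ : Finset ι, W), ι →₀ ℕ) → W := fun x => x.1.2 + ∑ j, (x.2 j : ℝ) • a j
    with hφ
  have hpos : ∀ x ∈ F, ∀ j ∈ x.1.1, 0 < coord a x.1.1 (φ x + s) j := by
    intro x hx j hj
    obtain ⟨⟨h1, h2⟩, -, -, h3⟩ := (hmem x).1 hx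
    rw [hφ, coord_add_sum_boxSet (D.isBase h1) h3]
    exact add_pos_of_pos_of_nonneg (((D.mem_box _ h1 _).1 h2).2 j hj).1 (Nat.cast_nonneg _)
  have hinj : Set.InjOn φ F := by
    rintro ⟨⟨B, q⟩, e⟩ hx ⟨⟨B', q'⟩, e'⟩ hx' heq
    have hp := hpos _ hx
    have hp' := hpos _ hx'
    rw [← heq] at hp'
    obtain ⟨⟨h1, h2⟩, -, -, h3⟩ := (hmem _).1 hx
    obtain ⟨⟨h1', h2'⟩, -, -, h3'⟩ := (hmem _).1 hx'
    dsimp only at *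
    obtain rfl := ((D.mem_lower B).1 h1).eq_of_coord_pos ((D.mem_lower B').1 h1') hp hp'
    have he : e = e' := by
      ext j
      rw [← floor_coord_add (D.isBase h1) h3 ((D.mem_box _ h1 _).1 h2) j,
        ← floor_coord_add (D.isBase h1) h3' ((D.mem_box _ h1 _).1 h2') j]
      simp only [hφ] at heq
      rw [heq]
    subst he
    simp only [hφ, add_left_inj] at heq
    rw [heq]
  have himg : (F.image φ : Set W) = {p | p ∈ M ∧ ht p = m ∧ InCone a p} := by
    ext p
    rw [Finset.coe_image]
    constructor
    · rintro ⟨x, hx, rfl⟩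
      have hx := Finset.mem_coe.1 hx
      have hp := hpos x hx
      obtain ⟨⟨h1, h2⟩, h3, h4, h5⟩ := (hmem x).1 hx
      have h2 := (D.mem_box _ h1 _).1 h2
      have hB := D.isBase h1
      have hM : φ x ∈ M := AddSubgroup.add_mem _ h2.1 (by simpa using D.sum_mem fun j => (x.2 j : ℤ))
      refine ⟨hM, ?_, ?_⟩
      · rw [hφ, map_add, D.ht_sum, (D.ht_of_mem_boxSet D.shift_inInt D.shift hB h2).1]
        have h6 : ∑ j, (x.2 j : ℝ) = (m - ⌊ht x.1.2⌋₊ : ℕ) := by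
          rw [← h4, Nat.cast_sum]
          refine (Finset.sum_subset (Finset.subset_univ _) fun j _ hj => ?_).symm
          simpa using fun hj' => hj (h5 (Finsupp.mem_support_iff.2 hj'))
        rw [h6, Nat.cast_sub h3]
        ring
      · refine (D.inCone_iff D.shift_inInt D.shift hM).2
          ⟨coord a x.1.1 (φ x + s), fun j => ?_, hB.isCoord.sum_apply _⟩
        by_cases hj : j ∈ x.1.1
        · exact (hp j hj).le
        · rw [hB.isCoord.apply_of_notMem _ j hj]
    · rintro ⟨hM, hm, hc⟩
      obtain ⟨B, hB, hpB⟩ := D.toLatticeConfig.toConfig.exists_isLower D.generic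
        ((D.inCone_iff D.shift_inInt D.shift hM).1 hc)
        fun B hB j hj => D.shift.coord_add_ne_zero hB hj hM
      obtain ⟨q, hq, e, he, rfl⟩ := D.exists_boxSet_add D.shift hB.1 hM hpB
      have hq' := D.ht_of_mem_boxSet D.shift_inInt D.shift hB.1 hq
      have hBT := (D.mem_lower B).2 hB
      have h6 : ∑ j, (e j : ℝ) = (B.sum e : ℕ) := by
        rw [Nat.cast_sum]
        refine (Finset.sum_subset (Finset.subset_univ _) fun j _ hj => ?_).symm
        simpa using fun hj' => hj (he (Finsupp.mem_support_iff.2 hj'))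
      rw [map_add, D.ht_sum, hq'.1, h6] at hm
      have hm : ⌊ht q⌋₊ + B.sum e = m := by exact_mod_cast hm
      refine ⟨⟨⟨B, q⟩, e⟩, Finset.mem_coe.2 ((hmem _).2 ⟨⟨hBT, (D.mem_box B hBT q).2 hq⟩, ?_, ?_,
        he⟩), rfl⟩
      · dsimp only; omega
      · dsimp only; omega
  rw [← himg, Set.ncard_coe_finset, Finset.card_image_of_injOn hinj, hF, Finset.card_sigma,
    Finset.sum_filter]
  refine Finset.sum_congr rfl fun x hx => ?_
  obtain ⟨h1, h2⟩ := Finset.mem_sigma.1 hx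
  have h3 := (D.ht_of_mem_boxSet D.shift_inInt D.shift (D.isBase h1) ((D.mem_box _ h1 _).1 h2)).2
  split_ifs with h4
  · rw [Finset.card_finsuppAntidiag_nat_eq_choose, D.card_base _ (D.isBase h1)]
    rw [show n + 1 + (m - ⌊ht x.2⌋₊) - 1 = n + m - ⌊ht x.2⌋₊ by omega]
    exact Nat.choose_symm_of_eq_add (by omega)
  · exact (Nat.choose_eq_zero_of_lt (by omega)).symm

/-- The coefficients of the counting function count the box points by height. -/
lemma BoxDecomposition.card_filter_eq (D : BoxDecomposition a M ht (n + 1) s ω T S) {h : ℕ → ℤ}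
    (hh : ∀ m : ℕ, ({p | p ∈ M ∧ ht p = m ∧ InCone a p}.ncard : ℤ) =
      ∑ i ∈ Finset.range (n + 1), h i * ((n + m - i).choose n : ℤ)) {i : ℕ} (hi : i ≤ n) :
    (((T.sigma S).filter fun x => ⌊ht x.2⌋₊ = i).card : ℤ) = h i := by
  refine eq_of_sum_mul_choose_eq
    (f := fun i => (((T.sigma S).filter fun x => ⌊ht x.2⌋₊ = i).card : ℤ)) (fun m => ?_) i hi
  rw [← hh, D.ncard_height, ← Finset.sum_fiberwise_of_maps_to (t := Finset.range (n + 1))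
    (g := fun x : (Σ _ : Finset ι, W) => ⌊ht x.2⌋₊)]
  · push_cast
    refine Finset.sum_congr rfl fun j _ => ?_
    rw [Finset.sum_congr rfl (g := fun _ => ((n + m - j).choose n : ℤ)), Finset.sum_const,
      nsmul_eq_mul]
    intro x hx
    rw [(Finset.mem_filter.1 hx).2]
  · intro x hx
    obtain ⟨h1, h2⟩ := Finset.mem_sigma.1 hx
    have h3 := (D.ht_of_mem_boxSet D.shift_inInt D.shift (D.isBase h1) ((D.mem_box _ h1 _).1 h2)).2
    rw [Finset.mem_range]; omega

lemma BoxDecomposition.sum_card (D : BoxDecomposition a M ht (n + 1) s ω T S) {h : ℕ → ℤ}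
    (hh : ∀ m : ℕ, ({p | p ∈ M ∧ ht p = m ∧ InCone a p}.ncard : ℤ) =
      ∑ i ∈ Finset.range (n + 1), h i * ((n + m - i).choose n : ℤ)) :
    ∑ i ∈ Finset.range (n + 1), h i = (∑ B ∈ T, (S B).card : ℕ) := by
  rw [← Finset.card_sigma, Finset.card_eq_sum_card_fiberwise (t := Finset.range (n + 1))
    (f := fun x : (Σ _ : Finset ι, W) => ⌊ht x.2⌋₊)]
  · rw [Nat.cast_sum]
    refine Finset.sum_congr rfl fun i hi => (D.card_filter_eq hh ?_).symm
    rw [Finset.mem_range] at hi; omega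
  · intro x hx
    obtain ⟨h1, h2⟩ := Finset.mem_sigma.1 hx
    have h3 := (D.ht_of_mem_boxSet D.shift_inInt D.shift (D.isBase h1) ((D.mem_box _ h1 _).1 h2)).2
    exact Finset.mem_coe.2 (Finset.mem_range.2 (Nat.lt_succ_of_le h3))

/-- Reciprocity: interior lattice points are reflected box points plus nonnegative integral
combinations. -/
lemma BoxDecomposition.exists_of_inInt (D : BoxDecomposition a M ht (n + 1) s ω T S)
    (hp : p ∈ M) (hint : InInt a p) : ∃ x ∈ T.sigma S, ∃ e : ι →₀ ℕ,
      p = ∑ j ∈ x.1, a j - x.2 + ∑ j, (e j : ℝ) • a j := by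
  obtain ⟨B, hB, hpB⟩ := D.toLatticeConfig.toConfig.exists_isLower D.generic
    ((D.inInt_iff D.shift_inInt D.shift hp).1 hint)
    fun B hB j hj => D.shift.neg.coord_add_ne_zero hB hj hp
  obtain ⟨q, hq, e, -, rfl⟩ := D.exists_boxSet_add D.shift.neg hB.1 hp hpB
  have hBT := (D.mem_lower B).2 hB
  exact ⟨⟨B, ∑ j ∈ B, a j - q⟩, Finset.mem_sigma.2 ⟨hBT, (D.mem_box B hBT _).2
    (reflect_mem_boxSet D.toLatticeConfig hB.1 hq)⟩, e, by simp⟩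

lemma BoxDecomposition.ht_reflect (D : BoxDecomposition a M ht (n + 1) s ω T S)
    {x : Σ _ : Finset ι, W} (hx : x ∈ T.sigma S) :
    ht (∑ j ∈ x.1, a j - x.2) + ⌊ht x.2⌋₊ = (n + 1 : ℕ) := by
  obtain ⟨h1, h2⟩ := Finset.mem_sigma.1 hx
  have h3 := (D.ht_of_mem_boxSet D.shift_inInt D.shift (D.isBase h1) ((D.mem_box _ h1 _).1 h2)).1
  rw [← h3, map_sub, map_sum, Finset.sum_congr rfl fun j _ => D.ht_eq j, Finset.sum_const,
    D.card_base _ (D.isBase h1), nsmul_eq_mul, mul_one, sub_add_cancel]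

lemma BoxDecomposition.boundedConfig (D : BoxDecomposition a M ht (n + 1) s ω T S) {h : ℕ → ℤ}
    (hh : ∀ m : ℕ, ({p | p ∈ M ∧ ht p = m ∧ InCone a p}.ncard : ℤ) =
      ∑ i ∈ Finset.range (n + 1), h i * ((n + m - i).choose n : ℤ))
    (hd : d ≤ n) (hk : h d = k) (h0 : ∀ i, d < i → h i = 0) :
    BoundedConfig a M ht (n + 1) d k := by
  classical
  have hle : ∀ x ∈ T.sigma S, ⌊ht x.2⌋₊ ≤ d := by
    intro x hx
    obtain ⟨h1, h2⟩ := Finset.mem_sigma.1 hx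
    have h3 := (D.ht_of_mem_boxSet D.shift_inInt D.shift (D.isBase h1)
      ((D.mem_box _ h1 _).1 h2)).2
    by_contra! hlt
    have h4 := D.card_filter_eq hh h3
    rw [h0 _ hlt, Nat.cast_eq_zero, Finset.card_eq_zero] at h4
    exact Finset.notMem_empty x (h4 ▸ Finset.mem_filter.2 ⟨hx, rfl⟩)
  have key : ∀ p ∈ M, InInt a p → ∃ x ∈ T.sigma S, ∃ e : ι →₀ ℕ,
      p = ∑ j ∈ x.1, a j - x.2 + ∑ j, (e j : ℝ) • a j ∧ ⌊ht x.2⌋₊ ≤ d ∧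
      ht p + ⌊ht x.2⌋₊ = (n + 1 : ℕ) + ∑ j, (e j : ℝ) := by
    intro p hp hint
    obtain ⟨x, hx, e, rfl⟩ := D.exists_of_inInt hp hint
    refine ⟨x, hx, e, rfl, hle x hx, ?_⟩
    rw [← D.ht_reflect hx, map_add, D.ht_sum]
    ring
  refine { D with int_height := ?_, few := ?_ }
  · intro p hp hint
    obtain ⟨x, -, e, -, h1, h2⟩ := key p hp hint
    have h3 : (0 : ℝ) ≤ ∑ j, (e j : ℝ) := Finset.sum_nonneg fun _ _ => Nat.cast_nonneg _
    have h4 : (⌊ht x.2⌋₊ : ℝ) ≤ d := by exact_mod_cast h1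
    linarith
  · intro z hz hinj
    have hsub : (Finset.Iic k).image z ⊆ ((T.sigma S).filter fun x => ⌊ht x.2⌋₊ = d).image
        fun x => ∑ j ∈ x.1, a j - x.2 := by
      intro p hp
      obtain ⟨t, ht', rfl⟩ := Finset.mem_image.1 hp
      obtain ⟨hM, hint, hht⟩ := hz t (Finset.mem_Iic.1 ht')
      obtain ⟨x, hx, e, h1, h2, h3⟩ := key _ hM hint
      have h5 : ∀ j ∈ Finset.univ, (0 : ℝ) ≤ e j := fun _ _ => Nat.cast_nonneg _
      have h4 : (⌊ht x.2⌋₊ : ℝ) ≤ d := by exact_mod_cast h2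
      have h6 : ∑ j, (e j : ℝ) = 0 := le_antisymm (by linarith) (Finset.sum_nonneg h5)
      have h7 : (⌊ht x.2⌋₊ : ℝ) = d := by linarith
      rw [Finset.sum_eq_zero_iff_of_nonneg h5] at h6
      refine Finset.mem_image.2 ⟨x, Finset.mem_filter.2 ⟨hx, by exact_mod_cast h7⟩, ?_⟩
      have h8 : ∑ j, (e j : ℝ) • a j = 0 :=
        Finset.sum_eq_zero fun j hj => by rw [h6 j hj, zero_smul]
      rw [h1, h8, add_zero]
    have hcard := (Finset.card_le_card hsub).trans Finset.card_image_le
    have h8 := D.card_filter_eq hh hd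
    rw [hk, Nat.cast_inj] at h8
    rw [h8, Finset.card_image_of_injOn (by simpa using hinj), Nat.card_Iic] at hcard
    omega

lemma BoxDecomposition.exists_isMinPoint (D : BoxDecomposition a M ht (n + 1) s ω T S)
    {h : ℕ → ℤ} (hh : ∀ m : ℕ, ({p | p ∈ M ∧ ht p = m ∧ InCone a p}.ncard : ℤ) =
      ∑ i ∈ Finset.range (n + 1), h i * ((n + m - i).choose n : ℤ))
    (hd : d ≤ n) (hk : h d ≠ 0) : ∃ x, IsMinPoint a M ht (n + 1) d x := by
  have h1 := D.card_filter_eq hh hd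
  have h2 : ((T.sigma S).filter fun x => ⌊ht x.2⌋₊ = d).Nonempty := by
    rw [← Finset.card_ne_zero]
    intro h0
    rw [h0] at h1
    exact hk h1.symm
  obtain ⟨x, hx⟩ := h2
  obtain ⟨hx, hxd⟩ := Finset.mem_filter.1 hx
  obtain ⟨h3, h4⟩ := Finset.mem_sigma.1 hx
  have hB := D.isBase h3
  have hq := (D.mem_box _ h3 _).1 h4
  have hr : ∑ j ∈ x.1, a j - x.2 ∈ boxSet a M (-s) x.1 :=
    reflect_mem_boxSet D.toLatticeConfig hB (by rwa [neg_neg])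
  refine ⟨∑ j ∈ x.1, a j - x.2, hr.1, (D.inInt_iff D.shift_inInt D.shift hr.1).2
    ⟨coord a x.1 (∑ j ∈ x.1, a j - x.2 + -s), fun j => ?_, hB.isCoord.sum_apply _⟩, ?_⟩
  · by_cases hj : j ∈ x.1
    · exact (hr.2 j hj).1.le
    · rw [hB.isCoord.apply_of_notMem _ j hj]
  · rw [← D.ht_reflect hx, hxd]

end LatticeCone

namespace LatticeCone

open Filter Topology

variable {n : ℕ}

/-- The integral points of `ℝ × ℝ^n`. -/
def integralPoints (n : ℕ) : AddSubgroup (ℝ × (Fin n → ℝ)) where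
  carrier := {p | (∃ t : ℤ, p.1 = t) ∧ IsLatticePoint p.2}
  zero_mem' := ⟨⟨0, by simp⟩, fun i => ⟨0, by simp⟩⟩
  add_mem' := by
    rintro p q ⟨⟨t, ht⟩, hp⟩ ⟨⟨u, hu⟩, hq⟩
    refine ⟨⟨t + u, by simp [ht, hu]⟩, fun i => ?_⟩
    obtain ⟨z, hz⟩ := hp i
    obtain ⟨w, hw⟩ := hq i
    exact ⟨z + w, by simp [hz, hw]⟩
  neg_mem' := by
    rintro p ⟨⟨t, ht⟩, hp⟩
    refine ⟨⟨-t, by simp [ht]⟩, fun i => ?_⟩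
    obtain ⟨z, hz⟩ := hp i
    exact ⟨-z, by simp [hz]⟩

lemma finite_integralPoints_inter_closedBall (R : ℝ) :
    {p | p ∈ integralPoints n ∧ ‖p‖ ≤ R}.Finite := by
  refine (((Set.finite_Icc ⌊-R⌋ ⌈R⌉).prod
    (Set.finite_Icc (fun _ : Fin n => ⌊-R⌋) fun _ => ⌈R⌉)).image
    fun q => ((q.1 : ℝ), fun i => (q.2 i : ℝ))).subset ?_
  rintro ⟨x, y⟩ ⟨⟨⟨t, ht⟩, hy⟩, hR⟩
  choose z hz using hy
  have key : ∀ (u : ℤ), ‖(u : ℝ)‖ ≤ R → ⌊-R⌋ ≤ u ∧ u ≤ ⌈R⌉ := by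
    intro u hu
    rw [Real.norm_eq_abs, abs_le] at hu
    exact ⟨by exact_mod_cast (Int.floor_le _).trans hu.1,
      by exact_mod_cast hu.2.trans (Int.le_ceil _)⟩
  rw [Prod.norm_def, max_le_iff] at hR
  have h1 := key t (by rw [← ht]; exact hR.1)
  have h2 := fun i => key (z i) (by rw [← hz]; exact (norm_le_pi_norm y i).trans hR.2)
  refine ⟨(t, z), ⟨h1, ⟨fun i => (h2 i).1, fun i => (h2 i).2⟩⟩, ?_⟩
  refine Prod.ext ht.symm (funext fun i => (hz i).symm)

/-- The points of a finite set, placed at height one. -/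
def homogenize (V : Finset (Fin n → ℝ)) (v : V) : ℝ × (Fin n → ℝ) := (1, v)

variable {V : Finset (Fin n → ℝ)}

lemma homogenize_injective : Function.Injective (homogenize V) :=
  fun _ _ h => Subtype.ext (Prod.ext_iff.1 h).2

lemma sum_smul_homogenize (c : V → ℝ) :
    ∑ v, c v • homogenize V v = (∑ v, c v, ∑ v, c v • (v : Fin n → ℝ)) := by
  refine Prod.ext ?_ ?_
  · simp [homogenize, Prod.fst_sum]
  · simp [homogenize, Prod.snd_sum]

lemma span_homogenize (hV : affineSpan ℝ (V : Set (Fin n → ℝ)) = ⊤) :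
    Submodule.span ℝ (Set.range (homogenize V)) = ⊤ := by
  set L := Submodule.span ℝ (Set.range (homogenize V))
  set f : (Fin n → ℝ) →ᵃ[ℝ] ℝ × (Fin n → ℝ) :=
    (LinearMap.inr ℝ ℝ (Fin n → ℝ)).toAffineMap + AffineMap.const ℝ _ (1, 0) with hf
  have hfy : ∀ y, f y = (1, y) := fun y => by simp [hf]
  have h1 : affineSpan ℝ (V : Set (Fin n → ℝ)) ≤ L.toAffineSubspace.comap f := by
    refine affineSpan_le.2 fun v hv => ?_
    change f v ∈ L
    rw [hfy]
    exact Submodule.subset_span ⟨⟨v, hv⟩, rfl⟩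
  have h2 : ∀ y : Fin n → ℝ, ((1, y) : ℝ × (Fin n → ℝ)) ∈ L := by
    intro y
    have : y ∈ affineSpan ℝ (V : Set (Fin n → ℝ)) := hV ▸ AffineSubspace.mem_top ℝ _ y
    rw [← hfy]
    exact h1 this
  refine Submodule.eq_top_iff'.2 fun p => ?_
  have : p = (p.1 - 1) • ((1, 0) : ℝ × (Fin n → ℝ)) + (1, p.2) := by
    refine Prod.ext ?_ ?_ <;> simp
  rw [this]
  exact L.add_mem (L.smul_mem _ (h2 0)) (h2 _)

lemma inCone_homogenize_iff (hne : V.Nonempty) (m : ℕ) (x : Fin n → ℝ) :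
    InCone (homogenize V) ((m : ℝ), x) ↔ x ∈ (m : ℝ) • convexHull ℝ (V : Set (Fin n → ℝ)) := by
  classical
  have hne' : (convexHull ℝ (V : Set (Fin n → ℝ))).Nonempty := by simpa using hne
  constructor
  · rintro ⟨c, hc, h⟩
    rw [sum_smul_homogenize, Prod.mk.injEq] at h
    obtain ⟨h1, h2⟩ := h
    rcases Nat.eq_zero_or_pos m with rfl | hm
    · rw [Nat.cast_zero, Finset.sum_eq_zero_iff_of_nonneg fun v _ => hc v] at h1
      rw [Nat.cast_zero, Set.zero_smul_set hne', ← h2]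
      exact Finset.sum_eq_zero fun v hv => by rw [h1 v hv, zero_smul]
    · have hm' : (0 : ℝ) < m := by exact_mod_cast hm
      refine ⟨(m : ℝ)⁻¹ • x, ?_, smul_inv_smul₀ hm'.ne' x⟩
      rw [← h2, Finset.smul_sum]
      simp only [smul_smul]
      refine (convex_convexHull ℝ _).sum_mem (fun v _ => mul_nonneg (by positivity) (hc v)) ?_
        fun v _ => subset_convexHull ℝ _ v.2
      rw [← Finset.mul_sum, h1, inv_mul_cancel₀ hm'.ne']
  · rintro ⟨y, hy, rfl⟩
    obtain ⟨w, hw, h1, rfl⟩ := Finset.mem_convexHull'.1 hy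
    refine ⟨fun v => m * w v, fun v => mul_nonneg (Nat.cast_nonneg _) (hw _ v.2), ?_⟩
    rw [sum_smul_homogenize, Prod.mk.injEq]
    constructor
    · rw [← Finset.mul_sum, Finset.sum_coe_sort V w, h1, mul_one]
    · simp only [mul_smul, ← Finset.smul_sum]
      rw [Finset.sum_coe_sort V fun v => w v • v]

lemma latticePointCount_eq (hne : V.Nonempty) (m : ℕ) :
    latticePointCount ((m : ℝ) • convexHull ℝ (V : Set (Fin n → ℝ))) =
      {p | p ∈ integralPoints n ∧ LinearMap.fst ℝ ℝ (Fin n → ℝ) p = m ∧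
        InCone (homogenize V) p}.ncard := by
  have hinj : Function.Injective
      fun z : Fin n → ℤ => (((m : ℝ), fun i => (z i : ℝ)) : ℝ × (Fin n → ℝ)) := by
    intro z w h
    ext i
    have := congrFun (Prod.ext_iff.1 h).2 i
    exact Int.cast_injective (α := ℝ) this
  rw [latticePointCount, ← Set.ncard_image_of_injective _ hinj]
  congr 1
  ext ⟨t, x⟩
  constructor
  · rintro ⟨z, hz, h⟩
    obtain ⟨rfl, rfl⟩ := Prod.mk.inj h
    exact ⟨⟨⟨m, by simp⟩, fun i => ⟨z i, rfl⟩⟩, rfl, (inCone_homogenize_iff hne m _).2 hz⟩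
  · rintro ⟨⟨-, hx⟩, rfl, hc⟩
    choose z hz using hx
    obtain rfl : x = fun i => (z i : ℝ) := funext hz
    exact ⟨z, (inCone_homogenize_iff hne m _).1 hc, rfl⟩

lemma latticeConfig_homogenize (hlat : ∀ v ∈ V, IsLatticePoint v)
    (hV : affineSpan ℝ (V : Set (Fin n → ℝ)) = ⊤) :
    LatticeConfig (homogenize V) (integralPoints n) (LinearMap.fst ℝ ℝ (Fin n → ℝ)) (n + 1) where
  mem v := ⟨⟨1, by simp [homogenize]⟩, hlat v v.2⟩
  ht_eq v := rfl
  ht_int z hz := hz.1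
  span := span_homogenize hV
  card_base B hB := by rw [hB.card_eq]; simp [add_comm]
  finite_box B hB := by
    refine (finite_integralPoints_inter_closedBall (∑ v, 2 * ‖homogenize V v‖)).subset
      fun p hp => ⟨hp.1, ?_⟩
    conv_lhs => rw [← hB.isCoord.sum_apply p]
    refine norm_sum_le_of_le _ fun v _ => ?_
    rw [norm_smul]
    exact mul_le_mul_of_nonneg_right (hp.2 v) (norm_nonneg _)

lemma card_inter_smul_span_eq (P : Set (Fin n → ℝ)) {m : ℕ} (hm : 0 < m) :
    Nat.card ↑(P ∩ (m : ℝ)⁻¹ • (Submodule.span ℤ (Set.range (Pi.basisFun ℝ (Fin n))) :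
      Set (Fin n → ℝ))) = latticePointCount ((m : ℝ) • P) := by
  have hm' : (m : ℝ) ≠ 0 := by exact_mod_cast hm.ne'
  have hinj : Function.Injective
      fun z : Fin n → ℤ => (m : ℝ)⁻¹ • fun i => (z i : ℝ) := by
    intro z w h
    ext i
    exact_mod_cast congrFun (smul_right_injective _ (inv_ne_zero hm') h) i
  rw [Nat.card_coe_set_eq, latticePointCount, ← Set.ncard_image_of_injective _ hinj]
  congr 1
  ext x
  constructor
  · rintro ⟨hx, y, hy, rfl⟩
    rw [SetLike.mem_coe, Module.Basis.mem_span_iff_repr_mem] at hy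
    choose z hz using hy
    obtain rfl : (fun i => (z i : ℝ)) = y := funext fun i => by simpa using hz i
    exact ⟨z, ⟨_, hx, smul_inv_smul₀ hm' _⟩, rfl⟩
  · rintro ⟨z, ⟨y, hy, hyz⟩, rfl⟩
    refine ⟨?_, _, ?_, rfl⟩
    · dsimp only at hyz ⊢
      rwa [← hyz, inv_smul_smul₀ hm']
    · rw [SetLike.mem_coe, Module.Basis.mem_span_iff_repr_mem]
      exact fun i => ⟨z i, by simp⟩

lemma normVol_le_sum_coeff {P : Set (Fin n → ℝ)} {h : Polynomial ℤ} (hP : IsLatticePolytope P)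
    (hh : IsHStarPoly P h) : normVol P ≤ ∑ i ∈ Finset.range (n + 1), (h.coeff i : ℝ) := by
  obtain ⟨V, -, -, rfl⟩ := hP
  set P := convexHull ℝ (V : Set (Fin n → ℝ))
  have hcomp : IsCompact P := V.finite_toSet.isCompact_convexHull ℝ
  have h1 := tendsto_card_div_pow_atTop_volume P hcomp.isBounded hcomp.measurableSet
    ((convex_convexHull ℝ _).addHaar_frontier _)
  have h2 : Tendsto (fun m : ℕ => (n.factorial : ℝ)⁻¹ *
      (∑ i ∈ Finset.range (n + 1), (h.coeff i : ℝ)) * ((n : ℝ) / m + 1) ^ n) atTop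
      (𝓝 ((n.factorial : ℝ)⁻¹ * (∑ i ∈ Finset.range (n + 1), (h.coeff i : ℝ)) * (0 + 1) ^ n)) :=
    (((tendsto_const_div_atTop_nhds_zero_nat (n : ℝ)).add_const 1).pow n).const_mul _
  have h3 := le_of_tendsto_of_tendsto h1 h2 ?_
  · rw [zero_add, one_pow, mul_one] at h3
    have hf : (0 : ℝ) < n.factorial := by exact_mod_cast n.factorial_pos
    rwa [inv_mul_eq_div, le_div_iff₀' hf] at h3
  · filter_upwards [eventually_gt_atTop 0] with m hm
    have hm' : (0 : ℝ) < m := by exact_mod_cast hm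
    rw [card_inter_smul_span_eq P hm, Fintype.card_fin, div_le_iff₀ (by positivity), mul_assoc,
      ← mul_pow, add_mul, div_mul_cancel₀ _ hm'.ne', one_mul]
    have h4 : (latticePointCount ((m : ℝ) • P) : ℝ) =
        ∑ i ∈ Finset.range (n + 1), (h.coeff i : ℝ) * ((n + m - i).choose n : ℝ) := by
      exact_mod_cast hh.2.2 m
    rw [h4, mul_assoc, Finset.sum_mul, Finset.mul_sum]
    refine Finset.sum_le_sum fun i _ => ?_
    have h5 : ((n + m - i).choose n : ℝ) ≤ ((n : ℝ) + m) ^ n / n.factorial := by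
      refine (Nat.choose_le_pow_div n (n + m - i)).trans ?_
      gcongr
      exact_mod_cast Nat.sub_le (n + m) i
    calc (h.coeff i : ℝ) * ((n + m - i).choose n : ℝ)
        ≤ h.coeff i * (((n : ℝ) + m) ^ n / n.factorial) :=
          mul_le_mul_of_nonneg_left h5 (by exact_mod_cast hh.2.1 i)
      _ = _ := by rw [div_eq_inv_mul]; ring

end LatticeCone

/-- (Theorem 1.1 / `main`.) There is a bound `B(d,k)`, depending only on
the degree `d` and the leading coefficient `k` of the `h^*`-polynomial, such that every
`n`-dimensional lattice polytope `P ⊆ ℝ^n` whose `h^*`-polynomial has degree `d` and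
leading coefficient `h^*_d = k` satisfies `Vol(P) ≤ B(d,k)`, independently of `n`. -/
theorem statement0 :
    ∃ B : ℕ × ℕ → ℝ, ∀ (n d k : ℕ) (P : Set (Fin n → ℝ)) (h : Polynomial ℤ),
      IsLatticePolytope P → affineSpan ℝ P = ⊤ →
      IsHStarPoly P h → h.natDegree = d → h.coeff d = (k : ℤ) →
      normVol P ≤ B (d, k) := by
  classical
  choose b hb using LatticeCone.exists_bound_sum_card_box
  refine ⟨fun x => b x.1 x.2, fun n d k P h hP hspan hh hd hk => ?_⟩
  refine (LatticeCone.normVol_le_sum_coeff hP hh).trans ?_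
  by_cases hk0 : k = 0
  · have : h = 0 := by
      rw [← Polynomial.leadingCoeff_eq_zero, Polynomial.leadingCoeff, hd, hk, hk0, Nat.cast_zero]
    simp [this]
  obtain ⟨V, hne, hlat, rfl⟩ := hP
  rw [affineSpan_convexHull] at hspan
  obtain ⟨s, ω, T, S, D⟩ := (LatticeCone.latticeConfig_homogenize hlat hspan).exists_boxDecomposition
  have hcount := fun m : ℕ => hh.2.2 m
  simp only [LatticeCone.latticePointCount_eq hne] at hcount
  have hdn : d ≤ n := hd ▸ hh.1
  obtain ⟨x, hx⟩ := D.exists_isMinPoint hcount hdn (by rw [hk]; exact_mod_cast hk0)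
  have hC := D.boundedConfig hcount hdn hk fun i hi =>
    Polynomial.coeff_eq_zero_of_natDegree_lt (hd ▸ hi)
  have hle := hb d k hC LatticeCone.homogenize_injective hx T (fun B hB => D.isBase hB) s S
    fun B hB p hp => (D.mem_box B hB p).1 hp
  have hsum := D.sum_card hcount
  have : (∑ i ∈ Finset.range (n + 1), (h.coeff i : ℝ)) = (∑ B ∈ T, (S B).card : ℕ) := by
    exact_mod_cast hsum
  rw [this]
  exact Nat.cast_le.2 hle

end
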